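/- arXiv:2107.02873 — 2 statements merged into one kernel-verified Lean document; each statement's English description precedes it below -/
import Mathlib

section
/- Let B be a block of k⟦G⟧ with non-trivial cyclic defect group D, and let P = P_S be the projective cover of a simple B-module S. Then the multiplicity of P as a direct factor of B (as a left B-module) is finite; it equals dim_k(S). -/
open scoped Classical
set_option maxHeartbeats 1000000
set_option synthInstance.maxHeartbeats 400000

noncomputable section

namespace ProfiniteBlocks

variable (k : Type) [Field k] (G : Type) [Group G] [TopologicalSpace G]

/-- Discrete topology on each finite level group algebra. -/
instance (X : Type) : TopologicalSpace (MonoidAlgebra k X) := ⊥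

/-- The canonical quotient homomorphism `G/N → G/M` for `N ≤ M`. -/
def qHom (N M : OpenNormalSubgroup G) (h : N ≤ M) :
    G ⧸ N.toSubgroup →* G ⧸ M.toSubgroup :=
  QuotientGroup.map _ _ (MonoidHom.id G) (fun x hx => h hx)

/-- The induced algebra homomorphism `k[G/N] → k[G/M]` for `N ≤ M`. -/
def tHom (N M : OpenNormalSubgroup G) (h : N ≤ M) :
    MonoidAlgebra k (G ⧸ N.toSubgroup) →ₐ[k] MonoidAlgebra k (G ⧸ M.toSubgroup) :=
  MonoidAlgebra.mapDomainAlgHom k k (qHom G N M h)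

/-- The completed group algebra `k⟦G⟧`, realized as the inverse limit of the finite
level group algebras `k[G/N]` over all open normal subgroups `N` of `G`, sitting inside
their product. -/
def CGA : Subalgebra k (∀ N : OpenNormalSubgroup G, MonoidAlgebra k (G ⧸ N.toSubgroup)) where
  carrier := {x | ∀ (N M : OpenNormalSubgroup G) (h : N ≤ M), tHom k G N M h (x N) = x M}
  add_mem' hx hy N M h := by simp [map_add, hx N M h, hy N M h]
  mul_mem' hx hy N M h := by simp [map_mul, hx N M h, hy N M h]
  algebraMap_mem' r N M h := by
    simp [tHom, MonoidAlgebra.mapDomainAlgHom, MonoidAlgebra.mapDomainRingHom,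
      Finsupp.mapDomain_single]

instance : Ring (CGA k G) := inferInstance
instance : Algebra k (CGA k G) := inferInstance

/-- `k⟦G⟧` carries the inverse limit topology (each `k[G/N]` being discrete). -/
instance : TopologicalSpace (CGA k G) := inferInstanceAs (TopologicalSpace (Subtype _))

/-- The canonical (continuous) inclusion of `G` into `k⟦G⟧`. -/
def ofG : G →* CGA k G where
  toFun g := ⟨fun N => MonoidAlgebra.single ((g : G) : G ⧸ N.toSubgroup) 1, by
    intro N M h
    simp [tHom, MonoidAlgebra.mapDomainAlgHom, MonoidAlgebra.mapDomainRingHom,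
      Finsupp.mapDomain_single, qHom, QuotientGroup.map_mk]
    rfl⟩
  map_one' := by
    ext N
    simp [MonoidAlgebra.one_def]
  map_mul' g g' := by
    ext N
    simp [MonoidAlgebra.single_mul_single]


/-- The map between quotient modules induced by `f` (the canonical map whenever
`f` carries `P` into `Q`). -/
def mapQ' {R X Y : Type} [Ring R] [AddCommGroup X] [AddCommGroup Y] [Module R X]
    [Module R Y] (P : Submodule R X) (Q : Submodule R Y) (f : X →ₗ[R] Y) :
    (X ⧸ P) →ₗ[R] (Y ⧸ Q) :=
  if h : P ≤ Q.comap f then Submodule.mapQ P Q f h else 0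

/-- The map between submodules induced by `f` (the canonical restriction whenever
`f` carries `P` into `Q`). -/
def restrict' {R X Y : Type} [Ring R] [AddCommGroup X] [AddCommGroup Y] [Module R X]
    [Module R Y] (P : Submodule R X) (Q : Submodule R Y) (f : X →ₗ[R] Y) :
    P →ₗ[R] Q :=
  if h : ∀ x ∈ P, f x ∈ Q then f.restrict h else 0

/-- The subquotient `W / W'` of a module. -/
abbrev subQuot {R X : Type} [Ring R] [AddCommGroup X] [Module R X]
    (W W' : Submodule R X) : Type :=
  W ⧸ (W'.comap W.subtype)

/-- The radical of a topological module: the intersection of its maximal open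
submodules. -/
def radical (R : Type) [Ring R] (X : Type) [AddCommGroup X] [Module R X]
    [TopologicalSpace X] : Submodule R X :=
  sInf {W : Submodule R X | IsCoatom W ∧ IsOpen (W : Set X)}

/-- Iterated radicals `Rad^i(X)`, with `Rad^0(X) = X`. -/
def radPow (R : Type) [Ring R] (X : Type) [AddCommGroup X] [Module R X]
    [TopologicalSpace X] : ℕ → Submodule R X
  | 0 => ⊤
  | (n + 1) => (radical R (radPow R X n)).map (radPow R X n).subtype

/-- A topological module is semisimple if every closed submodule has a closed
complement. -/
def IsSemisimpleTop (R : Type) [Ring R] (X : Type) [AddCommGroup X] [Module R X]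
    [TopologicalSpace X] : Prop :=
  ∀ W : Submodule R X, IsClosed (W : Set X) →
    ∃ W' : Submodule R X, IsClosed (W' : Set X) ∧ IsCompl W W'

/-- The socle of a topological module: the largest closed semisimple submodule
(defined as the join of all closed semisimple submodules). -/
def socle (R : Type) [Ring R] (X : Type) [AddCommGroup X] [Module R X]
    [TopologicalSpace X] : Submodule R X :=
  sSup {W : Submodule R X | IsClosed (W : Set X) ∧ IsSemisimpleTop R W}

/-- A module is uniserial if its submodules form a chain. -/
def Uniserial (R : Type) [Ring R] (X : Type) [AddCommGroup X] [Module R X] : Prop :=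
  ∀ W W' : Submodule R X, W ≤ W' ∨ W' ≤ W

/-- A topological module is (topologically) indecomposable if it is non-zero and
admits no non-trivial decomposition into closed direct summands. -/
def IsIndecTop (R : Type) [Ring R] (X : Type) [AddCommGroup X] [Module R X]
    [TopologicalSpace X] : Prop :=
  Nontrivial X ∧ ∀ W W' : Submodule R X, IsClosed (W : Set X) → IsClosed (W' : Set X) →
    IsCompl W W' → W = ⊥ ∨ W' = ⊥

/-- The inverse limit of a compatible system of modules indexed by a preorder,
realized as the submodule of compatible families in the product. -/
def compatLim {ι : Type} [Preorder ι] {R : Type} [Ring R] (T : ι → Type)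
    [∀ i, AddCommGroup (T i)] [∀ i, Module R (T i)]
    (t : ∀ i j, i ≤ j → (T i →ₗ[R] T j)) : Submodule R (∀ i, T i) where
  carrier := {f | ∀ (i j : ι) (h : i ≤ j), t i j h (f i) = f j}
  add_mem' ha hb i j h := by simp only [Pi.add_apply, map_add]; rw [ha i j h, hb i j h]
  zero_mem' i j h := by simp
  smul_mem' c a ha i j h := by simp only [Pi.smul_apply, map_smul]; rw [ha i j h]

/-- `X` has exactly `n` composition factors (measured along the radical series). -/
def HasNFactors (R : Type) [Ring R] (X : Type) [AddCommGroup X] [Module R X]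
    [TopologicalSpace X] (n : ℕ) : Prop :=
  radPow R X n = ⊥ ∧ ∀ m < n, radPow R X m ≠ ⊥

/-- `X` has infinitely many composition factors. -/
def HasInfFactors (R : Type) [Ring R] (X : Type) [AddCommGroup X] [Module R X]
    [TopologicalSpace X] : Prop :=
  ∀ n : ℕ, radPow R X n ≠ ⊥



section Coinvariants

variable {k : Type} [Field k] {G : Type} [Group G] [TopologicalSpace G]

variable (k G) in
/-- The (closed) submodule `I_N U` of a topological `k⟦G⟧`-module `U`: the smallest
closed submodule containing all elements `n • u - u` for `n ∈ N`.  Its quotient is the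
module of `N`-coinvariants. -/
def coinvKer (N : OpenNormalSubgroup G) (U : Type) [AddCommGroup U]
    [Module (CGA k G) U] [TopologicalSpace U] : Submodule (CGA k G) U :=
  sInf {W : Submodule (CGA k G) U | IsClosed (W : Set U) ∧
    ∀ n ∈ N.toSubgroup, ∀ u : U, ofG k G n • u - u ∈ W}

variable (k G) in
/-- The module of `N`-coinvariants `U_N` of a topological `k⟦G⟧`-module `U`. -/
abbrev coinv (N : OpenNormalSubgroup G) (U : Type) [AddCommGroup U]
    [Module (CGA k G) U] [TopologicalSpace U] : Type :=
  U ⧸ coinvKer k G N U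

variable (k G) in
/-- The canonical projection `φ_N : U → U_N`. -/
def phi (N : OpenNormalSubgroup G) (U : Type) [AddCommGroup U]
    [Module (CGA k G) U] [TopologicalSpace U] : U →ₗ[CGA k G] coinv k G N U :=
  (coinvKer k G N U).mkQ

lemma coinvKer_mono {N M : OpenNormalSubgroup G} (h : N ≤ M) (U : Type) [AddCommGroup U]
    [Module (CGA k G) U] [TopologicalSpace U] : coinvKer k G N U ≤ coinvKer k G M U :=
  sInf_le_sInf (fun W hW => ⟨hW.1, fun n hn u => hW.2 n (h hn) u⟩)

variable (k G) in
/-- The canonical projection `φ_{MN} : U_N → U_M` for `N ≤ M`. -/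
def phiT (N M : OpenNormalSubgroup G) (h : N ≤ M) (U : Type) [AddCommGroup U]
    [Module (CGA k G) U] [TopologicalSpace U] :
    coinv k G N U →ₗ[CGA k G] coinv k G M U :=
  Submodule.mapQ _ _ LinearMap.id (fun _ hx => coinvKer_mono h U hx)

variable (k G) in
/-- `N` acts trivially on the `k⟦G⟧`-module `W`. -/
def NTrivial (N : OpenNormalSubgroup G) (W : Type) [AddCommGroup W]
    [Module (CGA k G) W] : Prop :=
  ∀ n ∈ N.toSubgroup, ∀ w : W, ofG k G n • w = w

end Coinvariants

section Pseudocompact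

variable (k : Type) [Field k]

/-- A pseudocompact module over a topological `k`-algebra `A`: a Hausdorff topological
module possessing a basis of neighbourhoods of `0` consisting of open submodules of
finite codimension which intersect in `0`, and which is the inverse limit of the
corresponding discrete quotients. -/
structure IsPseudocompactMod (A : Type) [Ring A] [Algebra k A] [TopologicalSpace A]
    (X : Type) [AddCommGroup X] [Module k X] [Module A X] [IsScalarTower k A X]
    [TopologicalSpace X] : Prop where
  t2 : T2Space X
  addGroup : IsTopologicalAddGroup X
  contSMul : ContinuousSMul A X
  basis : (nhds (0 : X)).HasBasis
    (fun V : Submodule A X => IsOpen (V : Set X) ∧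
      FiniteDimensional k (X ⧸ V.restrictScalars k))
    (fun V => (V : Set X))
  inf_bot : (⨅ (V : Submodule A X) (_ : IsOpen (V : Set X) ∧
      FiniteDimensional k (X ⧸ V.restrictScalars k)), V) = ⊥
  complete : ∀ c : ∀ V : {V : Submodule A X // IsOpen (V : Set X) ∧
      FiniteDimensional k (X ⧸ V.restrictScalars k)}, X ⧸ V.1,
    (∀ (V W : {V : Submodule A X // IsOpen (V : Set X) ∧
        FiniteDimensional k (X ⧸ V.restrictScalars k)}), V.1 ≤ W.1 →
      mapQ' V.1 W.1 LinearMap.id (c V) = c W) →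
    ∃ x : X, ∀ V, c V = Submodule.Quotient.mk x

end Pseudocompact

section Blocks

variable (R : Type) [Ring R]

/-- A block idempotent: a centrally primitive idempotent of `R`. -/
structure IsBlockIdem (e : R) : Prop where
  idem : IsIdempotentElem e
  ne_zero : e ≠ 0
  central : e ∈ Set.center R
  primitive : ∀ f g : R, f ∈ Set.center R → g ∈ Set.center R → IsIdempotentElem f →
    IsIdempotentElem g → f * g = 0 → g * f = 0 → e = f + g → f = 0 ∨ g = 0

/-- The block `B = Re` determined by a central idempotent `e`, as a left `R`-module. -/
def blockMod (e : R) (he : e ∈ Set.center R) : Submodule R R where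
  carrier := {a : R | a * e = a}
  add_mem' := by intro a b ha hb; simp only [Set.mem_setOf_eq, add_mul] at *; rw [ha, hb]
  zero_mem' := by simp
  smul_mem' := by
    intro c a ha
    simp only [Set.mem_setOf_eq, smul_eq_mul, mul_assoc] at *
    rw [ha]

/-- A module belongs to the block of the central idempotent `e` if `e` acts as the
identity on it. -/
def InBlock {X : Type} [AddCommGroup X] [Module R X] (e : R) : Prop :=
  ∀ x : X, e • x = x

end Blocks

section Defect

variable {k : Type} [Field k] {G : Type} [Group G] [TopologicalSpace G]

variable (k G) in
/-- The conjugation action of `G` on `k⟦G⟧`. -/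
def conjAct (g : G) (x : CGA k G) : CGA k G :=
  ofG k G g * x * ofG k G g⁻¹

variable (k G) in
/-- The `H`-fixed points of `k⟦G⟧` under conjugation. -/
def fixedBy (H : Subgroup G) : Set (CGA k G) :=
  {x : CGA k G | ∀ h ∈ H, conjAct k G h x = x}

variable (k G) in
/-- The relative trace map `Tr_H^G` on `k⟦G⟧` (a finite sum over coset
representatives when `H` is open). -/
def trMap (H : Subgroup G) (x : CGA k G) : CGA k G :=
  ∑ᶠ c : G ⧸ H, conjAct k G (Quotient.out c) x

variable (k G) in
/-- The image `Tr_H^G(k⟦G⟧^H)`. -/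
def trImage (H : Subgroup G) : Set (CGA k G) :=
  trMap k G H '' fixedBy k G H

variable (k G) in
/-- `D` satisfies the defect property for `e`:
`e ∈ ⋂_N Tr_{DN}^G (k⟦G⟧^{DN})`. -/
def DefectProp (e : CGA k G) (D : Subgroup G) : Prop :=
  ∀ N : OpenNormalSubgroup G, e ∈ trImage k G (D ⊔ N.toSubgroup)

variable (k G) in
/-- `D` is a defect group of the block of `e`: a closed subgroup, minimal subject to
the defect property. -/
structure IsDefectGroup (e : CGA k G) (D : Subgroup G) : Prop where
  closed : IsClosed (D : Set G)
  defect : DefectProp k G e D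
  minimal : ∀ D' : Subgroup G, IsClosed ((D' : Set G)) → D' ≤ D →
    DefectProp k G e D' → D' = D

end Defect

section FiniteDefect

variable (k : Type) [Field k] (Q : Type) [Group Q]

/-- Conjugation on a finite level group algebra `k[Q]`. -/
def conjActF (q : Q) (x : MonoidAlgebra k Q) : MonoidAlgebra k Q :=
  MonoidAlgebra.single q 1 * x * MonoidAlgebra.single q⁻¹ 1

/-- `H`-fixed points of `k[Q]` under conjugation. -/
def fixedByF (H : Subgroup Q) : Set (MonoidAlgebra k Q) :=
  {x | ∀ h ∈ H, conjActF k Q h x = x}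

/-- The relative trace map `Tr_H^Q` on `k[Q]`. -/
def trMapF (H : Subgroup Q) (x : MonoidAlgebra k Q) : MonoidAlgebra k Q :=
  ∑ᶠ c : Q ⧸ H, conjActF k Q (Quotient.out c) x

/-- The image `Tr_H^Q(k[Q]^H)`. -/
def trImageF (H : Subgroup Q) : Set (MonoidAlgebra k Q) :=
  trMapF k Q H '' fixedByF k Q H

/-- `Dq` is a defect group of the block of `e` in the group algebra `k[Q]`. -/
structure IsDefectGroupF (e : MonoidAlgebra k Q) (Dq : Subgroup Q) : Prop where
  defect : e ∈ trImageF k Q Dq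
  minimal : ∀ D' : Subgroup Q, D' ≤ Dq → e ∈ trImageF k Q D' → D' = Dq

end FiniteDefect

section CyclicDefect

variable {k : Type} [Field k] {G : Type} [Group G] [TopologicalSpace G]

variable (G) in
/-- A subgroup is procyclic if it possesses a dense cyclic (abstract) subgroup. -/
def IsProcyclic (D : Subgroup G) : Prop :=
  ∃ g : G, closure ((Subgroup.zpowers g : Subgroup G) : Set G) = (D : Set G)

variable (G) in
/-- `D` is isomorphic, as a topological group, to the `p`-adic integers `ℤ_p`. -/
def IsZpGroup (p : ℕ) [Fact p.Prime] (D : Subgroup G) : Prop :=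
  ∃ φ : D ≃ₜ Multiplicative ℤ_[p], ∀ x y : D, φ (x * y) = φ x * φ y

variable (G) in
/-- `D` is a cyclic pro-`p` group: either a finite cyclic `p`-group or `ℤ_p`. -/
def IsCyclicProP (p : ℕ) [Fact p.Prime] (D : Subgroup G) : Prop :=
  (Finite D ∧ IsPGroup p D ∧ IsCyclic D) ∨ IsZpGroup G p D

end CyclicDefect

section Simples

variable {k : Type} [Field k] {G : Type} [Group G] [TopologicalSpace G]

variable (k G) in
/-- The projection `k⟦G⟧ → k[G/N]`. -/
def projN (N : OpenNormalSubgroup G) (x : CGA k G) :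
    MonoidAlgebra k (G ⧸ N.toSubgroup) :=
  (x : ∀ N : OpenNormalSubgroup G, MonoidAlgebra k (G ⧸ N.toSubgroup)) N

variable (k G) in
/-- `N` acts trivially on every simple module of the block of `e`. -/
def TrivOnSimples (e : CGA k G) (N : OpenNormalSubgroup G) : Prop :=
  ∀ (S : Type) [AddCommGroup S] [Module (CGA k G) S],
    IsSimpleModule (CGA k G) S → InBlock (CGA k G) (X := S) e → NTrivial k G N S

variable (k G) in
/-- Membership of `N` in the standard cofinal system `𝒩` for the block `B` of `e`
with defect group `D`: the coinvariant algebra `B_N` is a block of `k[G/N]` with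
defect group `DN/N`, and `N` acts trivially on every simple `B`-module. -/
structure GoodN (e : CGA k G) (D : Subgroup G) (N : OpenNormalSubgroup G) : Prop where
  blockN : IsBlockIdem (MonoidAlgebra k (G ⧸ N.toSubgroup)) (projN k G N e)
  defectN : IsDefectGroupF k (G ⧸ N.toSubgroup) (projN k G N e)
    (D.map (QuotientGroup.mk' N.toSubgroup))
  triv : TrivOnSimples k G e N

/-- A cofinal set of open normal subgroups. -/
def IsCofinal {G : Type} [Group G] [TopologicalSpace G]
    (𝒩 : Set (OpenNormalSubgroup G)) : Prop :=
  ∀ M : OpenNormalSubgroup G, ∃ N ∈ 𝒩, N ≤ M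

variable (k G) in
/-- A pseudocompact module is pro-uniserial (w.r.t. the cofinal system `𝒩`) if all
its coinvariant quotients at members of `𝒩` are uniserial. -/
def ProUniserial (𝒩 : Set (OpenNormalSubgroup G)) (U : Type) [AddCommGroup U]
    [Module (CGA k G) U] [TopologicalSpace U] : Prop :=
  ∀ N ∈ 𝒩, Uniserial (CGA k G) (coinv k G N U)

variable (k G) in
/-- `S` is a composition factor of the pseudocompact module `U`: it is a composition
factor of some finite coinvariant quotient `U_N`. -/
def IsCompFactorOf (U : Type) [AddCommGroup U] [Module (CGA k G) U]
    [TopologicalSpace U] (S : Type) [AddCommGroup S] [Module (CGA k G) S] : Prop :=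
  ∃ (N : OpenNormalSubgroup G) (W W' : Submodule (CGA k G) (coinv k G N U)),
    W' ≤ W ∧ Nonempty (subQuot W W' ≃ₗ[CGA k G] S)

variable (k G) in
/-- `S` is a composition factor of the finite-dimensional module `X`. -/
def IsCompFactorFin (X : Type) [AddCommGroup X] [Module (CGA k G) X]
    (S : Type) [AddCommGroup S] [Module (CGA k G) S] : Prop :=
  ∃ W W' : Submodule (CGA k G) X, W' ≤ W ∧ Nonempty (subQuot W W' ≃ₗ[CGA k G] S)

end Simples

section Projective

variable {k : Type} [Field k] {G : Type} [Group G] [TopologicalSpace G]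

variable (k G) in
/-- A pseudocompact `k⟦G⟧`-module is (categorically) projective if every continuous
surjection onto it from a pseudocompact module splits. -/
def IsPCProjective (P : Type) [AddCommGroup P] [Module (CGA k G) P]
    [TopologicalSpace P] : Prop :=
  ∀ (W : Type) [AddCommGroup W] [Module k W] [Module (CGA k G) W]
    [IsScalarTower k (CGA k G) W] [TopologicalSpace W],
    IsPseudocompactMod k (CGA k G) W →
    ∀ f : W →ₗ[CGA k G] P, Continuous f → Function.Surjective f →
      ∃ s : P →ₗ[CGA k G] W, Continuous s ∧ f.comp s = LinearMap.id

variable (k G) in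
/-- `P` is a projective cover of the simple module `S` in the block of `e`:
a pseudocompact projective module of the block together with a surjection onto `S`
whose kernel is superfluous (contained in the radical). -/
structure IsProjCover (e : CGA k G) (P : Type) [AddCommGroup P] [Module k P]
    [Module (CGA k G) P] [IsScalarTower k (CGA k G) P] [TopologicalSpace P]
    (S : Type) [AddCommGroup S] [Module (CGA k G) S] : Prop where
  pseudocompact : IsPseudocompactMod k (CGA k G) P
  inBlock : InBlock (CGA k G) (X := P) e
  projective : IsPCProjective k G P
  cover : ∃ π : P →ₗ[CGA k G] S, Function.Surjective π ∧
    LinearMap.ker π ≤ radical (CGA k G) P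

end Projective




/-- The map between subquotients induced by `f`. -/
def subQuotMap {R X Y : Type} [Ring R] [AddCommGroup X] [AddCommGroup Y] [Module R X]
    [Module R Y] (W W' : Submodule R X) (V V' : Submodule R Y) (f : X →ₗ[R] Y) :
    subQuot W W' →ₗ[R] subQuot V V' :=
  mapQ' (W'.comap W.subtype) (V'.comap V.subtype) (restrict' W V f)

/-- The conditions of Proposition 3.8 on a pair of pro-uniserial submodules `X`, `Y`
of an indecomposable projective `P`: `X ∩ Y = Soc(P)`, `X + Y = Rad(P)`, and
`Rad(P)/Soc(P) ≅ X/Soc(P) ⊕ Y/Soc(P)` with no common composition factors. -/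
def ProUniserialPair (k : Type) [Field k] (G : Type) [Group G] [TopologicalSpace G]
    (𝒩 : Set (OpenNormalSubgroup G)) (P : Type) [AddCommGroup P]
    [Module (CGA k G) P] [TopologicalSpace P]
    (X Y : Submodule (CGA k G) P) : Prop :=
  ProUniserial k G 𝒩 X ∧ ProUniserial k G 𝒩 Y ∧
  X ⊓ Y = socle (CGA k G) P ∧
  X ⊔ Y = radical (CGA k G) P ∧
  Nonempty ((subQuot (radical (CGA k G) P) (socle (CGA k G) P)) ≃ₗ[CGA k G]
    (subQuot X (socle (CGA k G) P) × subQuot Y (socle (CGA k G) P))) ∧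
  ∀ (T : Type) [AddCommGroup T] [Module (CGA k G) T], IsSimpleModule (CGA k G) T →
    ¬ (IsCompFactorOf k G (subQuot X (socle (CGA k G) P)) T ∧
       IsCompFactorOf k G (subQuot Y (socle (CGA k G) P)) T)

/-- `S : ι → Type` is a complete set of pairwise non-isomorphic representatives of
the simple modules of the block of `e`. -/
def IsSimpleReps (k : Type) [Field k] (G : Type) [Group G] [TopologicalSpace G]
    (e : CGA k G) {ι : Type} (S : ι → Type) [∀ i, AddCommGroup (S i)]
    [∀ i, Module (CGA k G) (S i)] : Prop :=
  (∀ i, IsSimpleModule (CGA k G) (S i) ∧ InBlock (CGA k G) (X := S i) e) ∧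
  (∀ i j, i ≠ j → IsEmpty (S i ≃ₗ[CGA k G] S j)) ∧
  (∀ (T : Type) [AddCommGroup T] [Module (CGA k G) T],
    IsSimpleModule (CGA k G) T → InBlock (CGA k G) (X := T) e →
      ∃ i, Nonempty (T ≃ₗ[CGA k G] S i))

section Brauer

/-- The size of the `ρ`-orbit of `i` (the number of edges at the corresponding vertex
of the Brauer tree). -/
def orbSize {ι : Type} (ρ : Equiv.Perm ι) (i : ι) : ℕ :=
  Function.minimalPeriod ρ i

/-- Data describing the exceptional vertex of a Brauer tree: `none` if there is no
exceptional vertex, and otherwise a flag recording whether it is a `ρ`-vertex or a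
`σ`-vertex together with an edge adjacent to it. -/
abbrev ExcVertex (ι : Type) : Type := Option (Bool × ι)

/-- The edge `i` is adjacent to the exceptional vertex, its `ρ`-endpoint being
exceptional. -/
def AdjExcRho {ι : Type} (ρ : Equiv.Perm ι) (exc : ExcVertex ι) (i : ι) : Prop :=
  ∃ j : ι, exc = some (true, j) ∧ ρ.SameCycle j i

/-- The edge `i` is adjacent to the exceptional vertex, its `σ`-endpoint being
exceptional. -/
def AdjExcSigma {ι : Type} (σ : Equiv.Perm ι) (exc : ExcVertex ι) (i : ι) : Prop :=
  ∃ j : ι, exc = some (false, j) ∧ σ.SameCycle j i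

/-- The edge `i` is adjacent to the exceptional vertex. -/
def AdjExc {ι : Type} (ρ σ : Equiv.Perm ι) (exc : ExcVertex ι) (i : ι) : Prop :=
  AdjExcRho ρ exc i ∨ AdjExcSigma σ exc i

end Brauer

section CompletedGroupAlgebra

variable {k : Type} [Field k] {G : Type} [Group G] [TopologicalSpace G]

instance discreteTopology_monoidAlgebra (X : Type) : DiscreteTopology (MonoidAlgebra k X) := ⟨rfl⟩

instance isTopologicalRing_CGA : IsTopologicalRing (CGA k G) :=
  inferInstanceAs (IsTopologicalRing (CGA k G).toSubring)

instance t2Space_CGA : T2Space (CGA k G) :=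
  inferInstanceAs (T2Space (Subtype _))

variable (k) in
/-- The projection `k⟦G⟧ → k[G/N]` as an algebra homomorphism. -/
def projHom (N : OpenNormalSubgroup G) : CGA k G →ₐ[k] MonoidAlgebra k (G ⧸ N.toSubgroup) :=
  (Pi.evalAlgHom k (fun N : OpenNormalSubgroup G => MonoidAlgebra k (G ⧸ N.toSubgroup)) N).comp
    (CGA k G).val

lemma projHom_apply (N : OpenNormalSubgroup G) (a : CGA k G) : projHom k N a = a.1 N := rfl

lemma tHom_projHom {N M : OpenNormalSubgroup G} (h : N ≤ M) (a : CGA k G) :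
    tHom k G N M h (projHom k N a) = projHom k M a := a.2 N M h

lemma continuous_projHom (N : OpenNormalSubgroup G) : Continuous (projHom k N) :=
  (continuous_apply N).comp continuous_subtype_val

lemma isOpen_ker_projHom (N : OpenNormalSubgroup G) :
    IsOpen (RingHom.ker (projHom k N) : Set (CGA k G)) :=
  (isOpen_discrete {0}).preimage (continuous_projHom N)

lemma ker_projHom_mono {N M : OpenNormalSubgroup G} (h : N ≤ M) :
    RingHom.ker (projHom k N) ≤ RingHom.ker (projHom k M) := fun a ha => by
  rw [RingHom.mem_ker] at *
  rw [← tHom_projHom h, ha, map_zero]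

instance : Nonempty (OpenNormalSubgroup G) := ⟨⟨⊤, (inferInstance : (⊤ : Subgroup G).Normal)⟩⟩

/-- The kernels of the projections to the finite levels are a neighbourhood basis of `0`. -/
lemma exists_ker_projHom_subset {U : Set (CGA k G)} (hU : U ∈ nhds 0) :
    ∃ N : OpenNormalSubgroup G, (RingHom.ker (projHom k N) : Set (CGA k G)) ⊆ U := by
  obtain ⟨V, hV, hVU⟩ := mem_nhds_subtype _ _ _ |>.1 hU
  rw [nhds_pi, Filter.mem_pi'] at hV
  obtain ⟨I, t, ht, htV⟩ := hV
  have : IsCodirectedOrder (OpenNormalSubgroup G) :=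
    ⟨fun N M => ⟨N ⊓ M, inf_le_left, inf_le_right⟩⟩
  obtain ⟨N, hN⟩ : ∃ N : OpenNormalSubgroup G, ∀ i ∈ I, N ≤ i :=
    Finset.exists_le (α := (OpenNormalSubgroup G)ᵒᵈ) I
  refine ⟨N, fun a ha => hVU (htV fun i hi => ?_)⟩
  have : a.1 i = 0 := ker_projHom_mono (hN i hi) ha
  rw [this]
  exact mem_of_mem_nhds (ht i)

variable (k) in
/-- The coefficient of `x` in the image of an element of `k⟦G⟧` in `k[G/N]`. -/
def coeffAt (N : OpenNormalSubgroup G) (x : G ⧸ N.toSubgroup) : CGA k G →ₗ[k] k :=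
  Finsupp.lapply x ∘ₗ (MonoidAlgebra.coeffLinearEquiv k).toLinearMap ∘ₗ (projHom k N).toLinearMap

lemma coeffAt_apply (N : OpenNormalSubgroup G) (x : G ⧸ N.toSubgroup) (a : CGA k G) :
    coeffAt k N x a = (projHom k N a).coeff x := rfl

lemma iInf_ker_coeffAt (N : OpenNormalSubgroup G) (a : CGA k G) :
    a ∈ ⨅ x, LinearMap.ker (coeffAt k N x) ↔ a ∈ RingHom.ker (projHom k N) := by
  simp only [Submodule.mem_iInf, LinearMap.mem_ker, coeffAt_apply, RingHom.mem_ker]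
  refine ⟨fun h => ?_, fun h x => by simp [h]⟩
  ext x
  simpa using h x

lemma coeff_tHom {N M : OpenNormalSubgroup G} (h : N ≤ M) [Fintype (G ⧸ N.toSubgroup)]
    (a : MonoidAlgebra k (G ⧸ N.toSubgroup)) (y : G ⧸ M.toSubgroup) :
    (tHom k G N M h a).coeff y = ∑ x, if qHom G N M h x = y then a.coeff x else 0 := by
  induction a using MonoidAlgebra.induction_linear with
  | zero => simp
  | add a b ha hb => simp [ha, hb, Finset.sum_add_distrib, ite_add_zero]
  | single x r =>
    have hx : tHom k G N M h (.single x r) = .single (qHom G N M h x) r := by simp [tHom]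
    rw [hx, Finset.sum_eq_single x]
    · simp [Finsupp.single_apply]
    · intro z _ hz
      simp [hz.symm]
    · simp

variable [IsTopologicalGroup G] [CompactSpace G]

instance finite_quotient (N : OpenNormalSubgroup G) : Finite (G ⧸ N.toSubgroup) :=
  Subgroup.quotient_finite_of_isOpen _ N.isOpen'

/-- `k⟦G⟧` is the full dual of its continuous dual: every functional on the latter is evaluation
at an element of `k⟦G⟧`. -/
lemma exists_eval_eq (ψ : Module.Dual k (CGA k G) →ₗ[k] k) :
    ∃ a : CGA k G, ∀ φ : Module.Dual k (CGA k G),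
      (∀ᶠ b in nhds 0, φ b = 0) → ψ φ = φ a := by
  have : ∀ N : OpenNormalSubgroup G, Fintype (G ⧸ N.toSubgroup) := fun N => Fintype.ofFinite _
  let a : CGA k G := ⟨fun N => .ofCoeff (Finsupp.equivFunOnFinite.symm
    fun x => ψ (coeffAt k N x)), by
    intro N M h
    ext y
    rw [coeff_tHom]
    have : coeffAt k M y = ∑ x, if qHom G N M h x = y then coeffAt k N x else 0 := by
      ext b
      rw [coeffAt_apply, ← tHom_projHom h, coeff_tHom]
      simp only [LinearMap.sum_apply]
      refine Finset.sum_congr rfl fun x _ => ?_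
      split_ifs <;> rfl
    simp [this, apply_ite]⟩
  refine ⟨a, fun φ hφ => ?_⟩
  obtain ⟨N, hN⟩ := exists_ker_projHom_subset hφ
  have hspan : φ ∈ Submodule.span k (Set.range (coeffAt k N)) :=
    mem_span_of_iInf_ker_le_ker fun b hb => hN ((iInf_ker_coeffAt N b).1 hb)
  clear hφ hN
  induction hspan using Submodule.span_induction with
  | mem φ h => 
    obtain ⟨x, rfl⟩ := h
    rfl
  | zero => simp
  | add φ φ' _ _ h h' => simp_all
  | smul c φ _ h => simp_all

lemma finiteDimensional_quotient_ker (N : OpenNormalSubgroup G) :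
    FiniteDimensional k (CGA k G ⧸ (RingHom.ker (projHom k N)).restrictScalars k) :=
  have : FiniteDimensional k (MonoidAlgebra k (G ⧸ N.toSubgroup)) :=
    Module.Finite.equiv (MonoidAlgebra.coeffLinearEquiv k).symm
  Module.Finite.equiv (projHom k N).toLinearMap.quotKerEquivRange.symm

lemma isPseudocompactMod_CGA : IsPseudocompactMod k (CGA k G) (CGA k G) where
  t2 := inferInstance
  addGroup := inferInstance
  contSMul := inferInstance
  basis := ⟨fun U => ⟨fun hU =>
    let ⟨N, hN⟩ := exists_ker_projHom_subset hU
    ⟨RingHom.ker (projHom k N), ⟨isOpen_ker_projHom N, finiteDimensional_quotient_ker N⟩, hN⟩,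
    fun ⟨V, hV, hVU⟩ => Filter.mem_of_superset (hV.1.mem_nhds V.zero_mem) hVU⟩⟩
  inf_bot := by
    refine eq_bot_iff.2 fun a ha => ?_
    simp only [Submodule.mem_iInf] at ha
    refine (Submodule.mem_bot _).2 (Subtype.ext (funext fun N => ?_))
    exact ha (RingHom.ker (projHom k N)) ⟨isOpen_ker_projHom N, finiteDimensional_quotient_ker N⟩
  complete := by
    intro c hc
    choose b hb using fun V => Submodule.Quotient.mk_surjective _ (c V)
    have hsub : ∀ V W, V.1 ≤ W.1 → b V - b W ∈ W.1 := by
      intro V W h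
      have := hc V W h
      rw [← hb V, ← hb W, mapQ', dif_pos (show V.1 ≤ W.1.comap LinearMap.id from h)] at this
      exact (Submodule.Quotient.eq _).1 this
    let K (N : OpenNormalSubgroup G) : {V : Submodule (CGA k G) (CGA k G) //
        IsOpen (V : Set (CGA k G)) ∧ FiniteDimensional k (CGA k G ⧸ V.restrictScalars k)} :=
      ⟨RingHom.ker (projHom k N), isOpen_ker_projHom N, finiteDimensional_quotient_ker N⟩
    let x : CGA k G := ⟨fun N => projHom k N (b (K N)), fun N M h => by
      rw [tHom_projHom, ← sub_eq_zero, ← map_sub]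
      exact hsub (K N) (K M) (ker_projHom_mono h)⟩
    refine ⟨x, fun V => ?_⟩
    obtain ⟨N, hN⟩ := exists_ker_projHom_subset (V.2.1.mem_nhds V.1.zero_mem)
    rw [← hb V, Submodule.Quotient.eq]
    have h₁ : b (K N) - x ∈ RingHom.ker (projHom k N) := by
      rw [RingHom.mem_ker, map_sub]
      exact sub_self _
    have h₂ := V.1.sub_mem (hN h₁) (hsub (K N) V hN)
    simpa using h₂

end CompletedGroupAlgebra

section PseudocompactModules

variable {k : Type} [Field k] {G : Type} [Group G] [TopologicalSpace G]
  {P : Type} [AddCommGroup P] [Module k P] [Module (CGA k G) P] [IsScalarTower k (CGA k G) P]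
  [TopologicalSpace P]

/-- Cyclic submodules of pseudocompact modules are closed: an element which generates every
finite-dimensional discrete quotient is a generator. -/
lemma smul_surjective_of_dense [IsTopologicalGroup G] [CompactSpace G]
    (hP : IsPseudocompactMod k (CGA k G) P) (x : P)
    (hx : ∀ V : Submodule (CGA k G) P, IsOpen (V : Set P) →
      FiniteDimensional k (P ⧸ V.restrictScalars k) → Submodule.span (CGA k G) {x} ⊔ V = ⊤)
    (z : P) : ∃ a : CGA k G, a • x = z := by
  have := hP.addGroup
  have := hP.contSMul
  let f : CGA k G →ₗ[k] P := (LinearMap.toSpanSingleton (CGA k G) P x).restrictScalars k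
  have hf : ∀ a, f a = a • x := fun a => rfl
  have hfc : Continuous f := continuous_id.smul continuous_const
  let P' : Submodule k (P →ₗ[k] k) :=
    { carrier := {φ | ∀ᶠ v in nhds 0, φ v = 0}
      add_mem' := fun {φ φ'} h h' => by
        filter_upwards [h, h'] with v hv hv'
        simp [hv, hv']
      zero_mem' := by simp
      smul_mem' := fun c φ h => by
        filter_upwards [h] with v hv
        simp [hv] }
  let F : P' →ₗ[k] CGA k G →ₗ[k] k := LinearMap.lcomp k k f ∘ₗ P'.subtype
  have hF : LinearMap.ker F = ⊥ := by
    refine LinearMap.ker_eq_bot'.2 fun φ hφ => Subtype.ext (LinearMap.ext fun v => ?_)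
    obtain ⟨V, ⟨hVo, hVf⟩, hV⟩ := hP.basis.mem_iff.1 φ.2
    have hv : v ∈ Submodule.span (CGA k G) {x} ⊔ V := hx V hVo hVf ▸ Submodule.mem_top
    obtain ⟨y, hy, w, hw, rfl⟩ := Submodule.mem_sup.1 hv
    obtain ⟨a, rfl⟩ := Submodule.mem_span_singleton.1 hy
    have h₁ : φ.1 w = 0 := hV hw
    have h₂ : φ.1 (a • x) = 0 := LinearMap.congr_fun hφ a
    simp [h₁, h₂]
  obtain ⟨ρ, hρ⟩ := LinearMap.exists_leftInverse_of_injective (K := k) (V := P') (V' := CGA k G →ₗ[k] k) F hF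
  obtain ⟨a, ha⟩ := exists_eval_eq (LinearMap.applyₗ z ∘ₗ P'.subtype ∘ₗ ρ)
  refine ⟨a, sub_eq_zero.1 ?_⟩
  rw [← Submodule.mem_bot (CGA k G), ← hP.inf_bot]
  simp only [Submodule.mem_iInf]
  intro V hV
  by_contra hmem
  obtain ⟨φ, hφ, hφV⟩ := Submodule.exists_le_ker_of_notMem (p := V.restrictScalars k) hmem
  have hφ' : φ ∈ P' := Filter.mem_of_superset (hV.1.mem_nhds V.zero_mem) fun v hv => hφV hv
  have hFφ : ∀ᶠ b in nhds 0, F ⟨φ, hφ'⟩ b = 0 := by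
    have : Filter.Tendsto f (nhds 0) (nhds 0) := by simpa using hfc.tendsto 0
    exact this.eventually hφ'
  have h := ha _ hFφ
  have h' : ρ (F ⟨φ, hφ'⟩) = ⟨φ, hφ'⟩ := LinearMap.congr_fun hρ _
  simp only [LinearMap.comp_apply, h'] at h
  apply hφ
  rw [map_sub, sub_eq_zero]
  exact h.symm

/-- A proper open submodule of finite codimension lies in an open maximal submodule. -/
lemma exists_le_isCoatom_of_isOpen (hP : IsPseudocompactMod k (CGA k G) P)
    (V : Submodule (CGA k G) P) (hVo : IsOpen (V : Set P))
    (hVf : FiniteDimensional k (P ⧸ V.restrictScalars k)) (W : Submodule (CGA k G) P)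
    (hVW : V ≤ W) (hW : W ≠ ⊤) :
    ∃ U : Submodule (CGA k G) P, IsCoatom U ∧ IsOpen (U : Set P) ∧ W ≤ U := by
  have := hP.addGroup
  have : FiniteDimensional k (P ⧸ V) :=
    Module.Finite.equiv (Submodule.Quotient.restrictScalarsEquiv k V)
  have : IsNoetherian (CGA k G) (P ⧸ V) := isNoetherian_of_tower k inferInstance
  obtain h | ⟨U, hU, hWU⟩ := eq_top_or_exists_le_coatom (W.map V.mkQ)
  · refine absurd ?_ hW
    have := V.comap_map_mkQ W
    rw [h, Submodule.comap_top, sup_eq_right.2 hVW] at this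
    exact this.symm
  · have hle : W ≤ U.comap V.mkQ := Submodule.map_le_iff_le_comap.1 hWU
    exact ⟨_, (Submodule.isCoatom_comap_iff V.mkQ_surjective).2 hU,
      AddSubgroup.isOpen_mono (H₁ := V.toAddSubgroup)
        (H₂ := (U.comap V.mkQ).toAddSubgroup) (hVW.trans hle) hVo, hle⟩

variable {S : Type} [AddCommGroup S] [Module (CGA k G) S]

omit [Module k P] [IsScalarTower k (CGA k G) P] in
/-- A maximal open submodule coincides with the kernel of a projective cover. -/
lemma eq_ker_of_isCoatom [IsSimpleModule (CGA k G) S] {π : P →ₗ[CGA k G] S}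
    (hπ : Function.Surjective π) (hker : LinearMap.ker π ≤ radical (CGA k G) P)
    {U : Submodule (CGA k G) P} (hU : IsCoatom U) (hUo : IsOpen (U : Set P)) :
    U = LinearMap.ker π :=
  ((LinearMap.isCoatom_ker_of_surjective hπ).le_iff_eq hU.1).1
    (hker.trans (sInf_le ⟨hU, hUo⟩))

/-- The top of a pseudocompact module with a unique maximal open submodule is
finite-dimensional. -/
lemma finiteDimensional_of_ker_le_radical [Module k S] [IsScalarTower k (CGA k G) S]
    [IsSimpleModule (CGA k G) S] (hP : IsPseudocompactMod k (CGA k G) P)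
    {π : P →ₗ[CGA k G] S} (hπ : Function.Surjective π)
    (hker : LinearMap.ker π ≤ radical (CGA k G) P) : FiniteDimensional k S := by
  have : Nontrivial S := IsSimpleModule.nontrivial (CGA k G) S
  have : Nontrivial P := hπ.nontrivial
  obtain ⟨V, hVo, hVf, hV⟩ : ∃ V : Submodule (CGA k G) P, IsOpen (V : Set P) ∧
      FiniteDimensional k (P ⧸ V.restrictScalars k) ∧ V ≠ ⊤ := by
    by_contra! h
    refine top_ne_bot (α := Submodule (CGA k G) P) ?_
    rw [← hP.inf_bot, eq_comm]
    simp only [iInf_eq_top]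
    exact fun V hV => h V hV.1 hV.2
  obtain ⟨U, hU, hUo, hVU⟩ := exists_le_isCoatom_of_isOpen hP V hVo hVf V le_rfl hV
  rw [eq_ker_of_isCoatom hπ hker hU hUo] at hVU
  refine Module.Finite.of_surjective
    ((V.restrictScalars k).liftQ (π.restrictScalars k) fun v hv => hVU hv) fun t => ?_
  obtain ⟨v, rfl⟩ := hπ t
  exact ⟨Submodule.Quotient.mk v, rfl⟩

variable [IsTopologicalGroup G] [CompactSpace G]

/-- Any element outside the radical generates a projective cover of a simple module. -/
lemma smul_surjective_of_notMem_ker [IsSimpleModule (CGA k G) S]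
    (hP : IsPseudocompactMod k (CGA k G) P) {π : P →ₗ[CGA k G] S} (hπ : Function.Surjective π)
    (hker : LinearMap.ker π ≤ radical (CGA k G) P) {x : P} (hx : π x ≠ 0) (z : P) :
    ∃ a : CGA k G, a • x = z := by
  refine smul_surjective_of_dense hP x (fun V hVo hVf => ?_) z
  by_contra hne
  obtain ⟨U, hU, hUo, hle⟩ := exists_le_isCoatom_of_isOpen hP V hVo hVf _ le_sup_right hne
  rw [eq_ker_of_isCoatom hπ hker hU hUo] at hle
  exact hx (hle (Submodule.mem_sup_left (Submodule.mem_span_singleton_self x)))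

end PseudocompactModules

/-- Nakayama's lemma for powers of a module in which every element outside the maximal submodule
`ker π` is a generator. -/
lemma surjective_of_surjective_top {R P S Y ι : Type} [Ring R] [AddCommGroup P] [Module R P]
    [AddCommGroup S] [Module R S] [IsSimpleModule R S] [AddCommGroup Y] [Module R Y] [Fintype ι]
    {π : P →ₗ[R] S} (hπ : Function.Surjective π)
    (hgen : ∀ x, π x ≠ 0 → ∀ z, ∃ a : R, a • x = z) (h : Y →ₗ[R] (ι → P))
    (hh : ∀ p : ι → P, ∃ y, ∀ i, π (h y i) = π (p i)) : Function.Surjective h := by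
  have : Nontrivial S := IsSimpleModule.nontrivial R S
  obtain ⟨s, hs⟩ := exists_ne (0 : S)
  obtain ⟨x, rfl⟩ := hπ s
  have : Module.Finite R P := Module.Finite.of_surjective (LinearMap.toSpanSingleton R P x)
    (hgen x hs)
  rw [← LinearMap.range_eq_top]
  by_contra hne
  obtain hU | ⟨U, hU, hle⟩ := eq_top_or_exists_le_coatom (LinearMap.range h)
  · exact hne hU
  have hkerU : ∀ i, LinearMap.ker π ≤ U.comap (LinearMap.single R (fun _ => P) i) := by
    intro i
    obtain hc | hc := Submodule.isCoatom_comap_or_eq_top (LinearMap.single R (fun _ => P) i) hU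
    · have hle : U.comap (LinearMap.single R (fun _ => P) i) ≤ LinearMap.ker π := by
        intro y hy
        by_contra hy'
        refine hc.1 (eq_top_iff.2 fun z _ => ?_)
        obtain ⟨a, rfl⟩ := hgen y hy' z
        exact Submodule.smul_mem _ a hy
      exact ((hc.le_iff_eq (LinearMap.isCoatom_ker_of_surjective hπ).1).1 hle).le
    · exact hc ▸ le_top
  refine hU.1 (eq_top_iff.2 fun p _ => ?_)
  obtain ⟨y, hy⟩ := hh p
  have hmem : p - h y ∈ U := by
    rw [← Finset.univ_sum_single (p - h y)]
    refine U.sum_mem fun i _ => hkerU i ?_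
    simp [hy i]
  simpa using U.add_mem hmem (hle (LinearMap.mem_range_self h y))

/-- Over an algebraically closed field, an algebra acts on a finite-dimensional simple module by
arbitrary linear endomorphisms. -/
lemma exists_smul_basis_eq {k A S ι : Type} [Field k] [IsAlgClosed k] [Ring A] [Algebra k A]
    [AddCommGroup S] [Module k S] [Module A S] [IsScalarTower k A S] [IsSimpleModule A S]
    [FiniteDimensional k S] [Fintype ι] (b : Module.Basis ι k S) (τ : ι → S) :
    ∃ a : A, ∀ i, a • b i = τ i := by
  let f : Module.End (Module.End A S) S :=
    { toFun := b.constr k τ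
      map_add' := map_add _
      map_smul' := fun g s => by
        obtain ⟨c, rfl⟩ :=
          (IsSimpleModule.algebraMap_end_bijective_of_isAlgClosed (A := A) (V := S) k).2 g
        simp }
  obtain ⟨a, ha⟩ := jacobson_density (R := A) f (Finset.univ.image b)
  refine ⟨a, fun i => ?_⟩
  rw [← ha (b i) (Finset.mem_image_of_mem _ (Finset.mem_univ i))]
  exact b.constr_basis k τ i

/-- Lemma 3.5: the multiplicity of the projective cover `P = P_S`
as a direct factor of the block `B` (as a left module) is finite, and equals
`dim_k S`. -/
theorem multiplicity_of_projective_in_block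
    (p : ℕ) [Fact p.Prime] (k : Type) [Field k] [CharP k p] [IsAlgClosed k]
    (G : Type) [Group G] [TopologicalSpace G] [IsTopologicalGroup G]
    [CompactSpace G] [TotallyDisconnectedSpace G] [T2Space G]
    (e : CGA k G) (he : IsBlockIdem (CGA k G) e)
    (D : Subgroup G) (hD : IsDefectGroup k G e D)
    (hcyc : IsCyclicProP G p D) (hnt : D ≠ ⊥)
    (S : Type) [AddCommGroup S] [Module k S] [Module (CGA k G) S]
    [IsScalarTower k (CGA k G) S]
    (hS : IsSimpleModule (CGA k G) S) (hSe : InBlock (CGA k G) (X := S) e)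
    (P : Type) [AddCommGroup P] [Module k P] [Module (CGA k G) P]
    [IsScalarTower k (CGA k G) P] [TopologicalSpace P]
    (hP : IsProjCover k G e P S) :
    ∃ m : ℕ, m = Module.finrank k S ∧
      ∃ W C : Submodule (CGA k G) (blockMod (CGA k G) e he.central),
        IsClosed (W : Set (blockMod (CGA k G) e he.central)) ∧
        IsClosed (C : Set (blockMod (CGA k G) e he.central)) ∧
        IsCompl W C ∧
        Nonempty (W ≃ₗ[CGA k G] (Fin m → P)) ∧
        ∀ C₁ C₂ : Submodule (CGA k G) C, IsClosed (C₁ : Set C) →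
          IsClosed (C₂ : Set C) → IsCompl C₁ C₂ →
            ¬ Nonempty (C₁ ≃ₗ[CGA k G] P) := by
  have := hS
  have := hP.pseudocompact.t2
  have := hP.pseudocompact.addGroup
  have := hP.pseudocompact.contSMul
  have : Nontrivial S := IsSimpleModule.nontrivial (CGA k G) S
  obtain ⟨π, hπ, hker⟩ := hP.cover
  have hfin : FiniteDimensional k S :=
    finiteDimensional_of_ker_le_radical hP.pseudocompact hπ hker
  have hgen : ∀ x, π x ≠ 0 → ∀ z, ∃ a : CGA k G, a • x = z := fun x hx z =>
    smul_surjective_of_notMem_ker hP.pseudocompact hπ hker hx z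
  obtain ⟨x, hx⟩ : ∃ x, π x ≠ 0 := by
    obtain ⟨s, hs⟩ := exists_ne (0 : S)
    obtain ⟨x, rfl⟩ := hπ s
    exact ⟨x, hs⟩
  obtain ⟨s₀, hs₀c, hs₀⟩ := hP.projective (CGA k G) isPseudocompactMod_CGA
    (LinearMap.toSpanSingleton (CGA k G) P x) (continuous_id.smul continuous_const) (hgen x hx)
  have hs₀x : ∀ z, s₀ z • x = z := fun z => LinearMap.congr_fun hs₀ z
  let b := Module.finBasis k S
  choose y hy using fun j => hπ (b j)
  let B := blockMod (CGA k G) e he.central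
  have heB : ∀ a : CGA k G, a * e ∈ B := fun a => by
    change a * e * e = a * e
    rw [mul_assoc, he.idem.eq]
  let h : B →ₗ[CGA k G] (Fin (Module.finrank k S) → P) :=
    LinearMap.pi fun j => LinearMap.toSpanSingleton (CGA k G) P (y j) ∘ₗ B.subtype
  have h_apply : ∀ c j, h c j = c.1 • y j := fun c j => rfl
  have hcont : Continuous h := continuous_pi fun j => continuous_subtype_val.smul continuous_const
  have hsurj : Function.Surjective h := by
    refine surjective_of_surjective_top hπ hgen h fun p => ?_
    obtain ⟨a, ha⟩ := exists_smul_basis_eq (A := CGA k G) b fun j => π (p j)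
    refine ⟨⟨a * e, heB a⟩, fun j => ?_⟩
    rw [h_apply, mul_smul, hP.inBlock, map_smul, hy, ha]
  choose β hβ using fun j => hsurj (Pi.single j x)
  let s : (Fin (Module.finrank k S) → P) →ₗ[CGA k G] B :=
    ∑ j, LinearMap.toSpanSingleton (CGA k G) B (β j) ∘ₗ s₀ ∘ₗ LinearMap.proj j
  have s_apply : ∀ p, s p = ∑ j, s₀ (p j) • β j := fun p => by simp [s]
  have hscont : Continuous s := by
    simp only [funext s_apply]
    exact continuous_finsetSum _ fun j _ =>
      (hs₀c.comp (continuous_apply j)).smul continuous_const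
  have hhs : ∀ p, h (s p) = p := fun p => by
    rw [s_apply, map_sum]
    simp only [map_smul, hβ, ← Pi.single_smul, hs₀x]
    exact Finset.univ_sum_single p
  have hrange : (LinearMap.range s : Set B) = {c | s (h c) = c} := by
    ext c
    exact ⟨fun ⟨p, hp⟩ => by rw [← hp]; exact congrArg s (hhs p), fun hc => ⟨h c, hc⟩⟩
  refine ⟨_, rfl, LinearMap.range s, LinearMap.ker h, ?_, ?_, ?_, ?_, ?_⟩
  · rw [hrange]
    exact isClosed_eq (hscont.comp hcont) continuous_id
  · exact isClosed_singleton.preimage hcont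
  · refine IsCompl.of_eq (eq_bot_iff.2 ?_) (eq_top_iff.2 fun c _ => ?_)
    · rintro _ ⟨⟨p, rfl⟩, hp⟩
      have : p = 0 := by rw [← hhs p]; exact hp
      simp [this]
    · rw [← add_sub_cancel (s (h c)) c]
      exact Submodule.add_mem_sup (LinearMap.mem_range_self s _) (by simp [hhs])
  · exact ⟨(LinearEquiv.ofInjective s (Function.LeftInverse.injective hhs)).symm⟩
  · rintro C₁ C₂ - - hC ⟨φ⟩
    let r : B →ₗ[CGA k G] LinearMap.ker h :=
      (LinearMap.id - s ∘ₗ h).codRestrict _ fun c => by simp [hhs]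
    have hr : ∀ c : LinearMap.ker h, r c = c := fun c => Subtype.ext (by simp [r])
    let u : LinearMap.ker h →ₗ[CGA k G] S :=
      π ∘ₗ φ.toLinearMap ∘ₗ Submodule.projectionOnto C₁ C₂ hC
    have hu : Function.Surjective u :=
      hπ.comp (φ.surjective.comp (Submodule.projectionOnto_surjective hC))
    have hu0 : ∀ c, u c = 0 := by
      intro c
      have hc : c.1 = c.1.1 • (⟨e, by simpa using heB 1⟩ : B) := Subtype.ext c.1.2.symm
      rw [← hr c, hc, map_smul, map_smul, ← b.sum_repr (u (r _)), Finset.smul_sum]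
      refine Finset.sum_eq_zero fun j _ => ?_
      rw [smul_algebra_smul_comm, ← hy j, ← map_smul, ← h_apply, LinearMap.mem_ker.1 c.2]
      simp
    obtain ⟨t, ht⟩ := exists_ne (0 : S)
    obtain ⟨c, rfl⟩ := hu t
    exact ht (hu0 c)

end ProfiniteBlocks
end
end

section
/- Let B be a block of k⟦G⟧ with non-trivial cyclic defect group D, let P be an indecomposable projective B-module, and let 𝒩 be a cofinal system of open normal subgroups N of G such that B_N is a block of k[G/N] with defect group DN/N and N acts trivially on every simple B-module. Then Rad(P)/Soc(P) is isomorphic to the inverse limit over N ∈ 𝒩 of Rad(P_N)/Soc(P_N). -/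
open scoped Classical
set_option maxHeartbeats 1000000
set_option synthInstance.maxHeartbeats 400000

noncomputable section

namespace ProfiniteBlocks

variable (k : Type) [Field k] (G : Type) [Group G] [TopologicalSpace G]

section CosetFilters

variable {A : Type} [Ring A] {X : Type} [AddCommGroup X] [Module A X] [TopologicalSpace X]

variable (A) in
/-- A coset of a closed submodule. -/
def IsClosedCoset (C : Set X) : Prop :=
  ∃ (x : X) (W : Submodule A X), IsClosed (W : Set X) ∧ C = {y | y - x ∈ W}

variable (A) in
/-- A family of non-empty closed cosets containing the whole module and closed under binary
intersections. -/
structure IsCosetFilter (𝓜 : Set (Set X)) : Prop where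
  coset : ∀ C ∈ 𝓜, IsClosedCoset A C
  nonempty : ∀ C ∈ 𝓜, C.Nonempty
  inter : ∀ C ∈ 𝓜, ∀ C' ∈ 𝓜, C ∩ C' ∈ 𝓜
  univ : Set.univ ∈ 𝓜

omit [TopologicalSpace X] in
lemma coset_eq_of_mem {W : Submodule A X} {x z : X} (h : z - x ∈ W) :
    {y | y - x ∈ W} = {y | y - z ∈ W} := by
  ext y
  constructor
  · intro hy
    simpa using W.sub_mem hy h
  · intro hy
    simpa using W.add_mem hy h

lemma IsClosedCoset.inter {C C' : Set X} (hC : IsClosedCoset A C) (hC' : IsClosedCoset A C')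
    (hne : (C ∩ C').Nonempty) : IsClosedCoset A (C ∩ C') := by
  obtain ⟨x, W, hW, rfl⟩ := hC
  obtain ⟨x', W', hW', rfl⟩ := hC'
  obtain ⟨z, hz, hz'⟩ := hne
  refine ⟨z, W ⊓ W', hW.inter hW', ?_⟩
  rw [coset_eq_of_mem hz, coset_eq_of_mem hz']
  rfl

lemma IsCosetFilter.exists_maximal {𝓜 : Set (Set X)} (h : IsCosetFilter A 𝓜) :
    ∃ 𝓝, 𝓜 ⊆ 𝓝 ∧ Maximal (IsCosetFilter A) 𝓝 := by
  refine zorn_subset_nonempty {𝓜 | IsCosetFilter A 𝓜} ?_ 𝓜 h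
  intro c hc hchain ⟨𝓐, h𝓐⟩
  refine ⟨⋃₀ c, ⟨?_, ?_, ?_, ⟨𝓐, h𝓐, (hc h𝓐).univ⟩⟩, fun s hs => Set.subset_sUnion_of_mem hs⟩
  · rintro C ⟨𝓑, h𝓑, hC⟩
    exact (hc h𝓑).coset C hC
  · rintro C ⟨𝓑, h𝓑, hC⟩
    exact (hc h𝓑).nonempty C hC
  · rintro C ⟨𝓑, h𝓑, hC⟩ C' ⟨𝓑', h𝓑', hC'⟩
    rcases hchain.total h𝓑 h𝓑' with hle | hle
    · exact ⟨𝓑', h𝓑', (hc h𝓑').inter C (hle hC) C' hC'⟩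
    · exact ⟨𝓑, h𝓑, (hc h𝓑).inter C hC C' (hle hC')⟩

lemma IsCosetFilter.mem_of_maximal {𝓜 : Set (Set X)} (h : Maximal (IsCosetFilter A) 𝓜)
    {C : Set X} (hC : IsClosedCoset A C) (hmeet : ∀ F ∈ 𝓜, (F ∩ C).Nonempty) : C ∈ 𝓜 := by
  have key : IsCosetFilter A (𝓜 ∪ (fun F => F ∩ C) '' 𝓜) := by
    refine ⟨?_, ?_, ?_, Or.inl h.prop.univ⟩
    · rintro _ (hF | ⟨F, hF, rfl⟩)
      · exact h.prop.coset _ hF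
      · exact (h.prop.coset F hF).inter hC (hmeet F hF)
    · rintro _ (hF | ⟨F, hF, rfl⟩)
      · exact h.prop.nonempty _ hF
      · exact hmeet F hF
    · rintro F (hF | ⟨F, hF, rfl⟩) F' (hF' | ⟨F', hF', rfl⟩)
      · exact Or.inl (h.prop.inter F hF F' hF')
      · exact Or.inr ⟨_, h.prop.inter F hF F' hF', by simp only [Set.inter_assoc]⟩
      · refine Or.inr ⟨_, h.prop.inter F hF F' hF', ?_⟩
        ext y
        simp only [Set.mem_inter_iff]
        tauto
      · refine Or.inr ⟨_, h.prop.inter F hF F' hF', ?_⟩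
        ext y
        simp only [Set.mem_inter_iff]
        tauto
  exact h.le_of_ge key Set.subset_union_left
    (Or.inr ⟨Set.univ, h.prop.univ, Set.univ_inter C⟩)

lemma IsCosetFilter.mem_of_superset {𝓜 : Set (Set X)} (h : Maximal (IsCosetFilter A) 𝓜)
    {F C : Set X} (hF : F ∈ 𝓜) (hC : IsClosedCoset A C) (hFC : F ⊆ C) : C ∈ 𝓜 :=
  IsCosetFilter.mem_of_maximal h hC fun F' hF' =>
    (h.prop.nonempty _ (h.prop.inter F' hF' F hF)).mono
      (Set.inter_subset_inter_right F' hFC)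

lemma isClosed_of_isOpen_submodule [IsTopologicalAddGroup X] {V : Submodule A X}
    (hV : IsOpen (V : Set X)) : IsClosed (V : Set X) :=
  V.toAddSubgroup.isClosed_of_isOpen hV

lemma isOpen_submodule_of_le [IsTopologicalAddGroup X] {V W : Submodule A X} (h : V ≤ W)
    (hV : IsOpen (V : Set X)) : IsOpen (W : Set X) :=
  AddSubgroup.isOpen_mono (H₁ := V.toAddSubgroup) (H₂ := W.toAddSubgroup) h hV

/-- A maximal coset filter contains a coset of every open submodule with artinian quotient. -/
lemma IsCosetFilter.exists_coset_mem [IsTopologicalAddGroup X] {𝓜 : Set (Set X)}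
    (h : Maximal (IsCosetFilter A) 𝓜) (V : Submodule A X) (hV : IsOpen (V : Set X))
    [IsArtinian A (X ⧸ V)] : ∃ x, {y | y - x ∈ V} ∈ 𝓜 := by
  obtain ⟨U, ⟨x, hx⟩, hmin⟩ := IsArtinian.set_has_minimal
    {U : Submodule A (X ⧸ V) | ∃ x, {y | y - x ∈ U.comap V.mkQ} ∈ 𝓜}
    ⟨⊤, 0, by simpa using h.prop.univ⟩
  have hVU : V ≤ U.comap V.mkQ := by
    intro v hv
    simp [(Submodule.Quotient.mk_eq_zero V).2 hv]
  refine ⟨x, IsCosetFilter.mem_of_maximal h ⟨x, V, isClosed_of_isOpen_submodule hV, rfl⟩ ?_⟩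
  intro F hF
  obtain ⟨z, Z, -, rfl⟩ := h.prop.coset F hF
  have hZV : IsClosed ((Z ⊔ V : Submodule A X) : Set X) :=
    isClosed_of_isOpen_submodule (isOpen_submodule_of_le le_sup_right hV)
  have hmem : {y | y - z ∈ Z ⊔ V} ∈ 𝓜 :=
    IsCosetFilter.mem_of_superset h hF ⟨z, _, hZV, rfl⟩
      (fun y hy => Submodule.mem_sup_left hy)
  have hint := h.prop.inter _ hx _ hmem
  obtain ⟨w, hwx, hwz⟩ := h.prop.nonempty _ hint
  have hcomap : (U ⊓ (Z ⊔ V).map V.mkQ).comap V.mkQ = U.comap V.mkQ ⊓ (Z ⊔ V) := by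
    rw [Submodule.comap_inf, Submodule.comap_map_mkQ]
    congr 1
    exact sup_eq_right.2 le_sup_right
  have hle : U.comap V.mkQ ≤ Z ⊔ V := by
    have hnot := hmin (U ⊓ (Z ⊔ V).map V.mkQ) ⟨w, by
      rw [hcomap]
      convert hint using 1
      rw [coset_eq_of_mem (W := U.comap V.mkQ) hwx, coset_eq_of_mem (W := Z ⊔ V) hwz]
      rfl⟩
    have heq : U ⊓ (Z ⊔ V).map V.mkQ = U :=
      eq_of_le_of_not_lt inf_le_left hnot
    rw [heq] at hcomap
    exact hcomap ▸ inf_le_right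
  have hxz : x - z ∈ Z ⊔ V := by
    simpa using (Z ⊔ V).sub_mem hwz (hle hwx)
  obtain ⟨a, ha, v, hv, hav⟩ := Submodule.mem_sup.1 hxz
  refine ⟨z + a, by simpa using ha, ?_⟩
  have : z + a - x = -v := by
    rw [eq_sub_iff_add_eq] at hav
    rw [← hav]
    abel
  simpa [this] using hv

end CosetFilters

section LinearlyCompact

/-- Linearly compact Hausdorff topological modules with a basis of open submodules whose
quotients are artinian. -/
structure IsLinearlyCompact (A : Type) [Ring A] (X : Type) [AddCommGroup X] [Module A X]
    [TopologicalSpace X] : Prop where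
  t2 : T2Space X
  addGroup : IsTopologicalAddGroup X
  basis : ∀ s ∈ nhds (0 : X), ∃ V : Submodule A X, IsOpen (V : Set X) ∧
    IsArtinian A (X ⧸ V) ∧ (V : Set X) ⊆ s
  exists_mem_cosets : ∀ (ι : Type) [Preorder ι], (∀ i j : ι, ∃ l, l ≤ i ∧ l ≤ j) →
    ∀ W : ι → Submodule A X, (∀ i, IsClosed (W i : Set X)) → Monotone W →
    ∀ x : ι → X, (∀ i j, i ≤ j → x i - x j ∈ W j) → ∃ y, ∀ i, y - x i ∈ W i

lemma isArtinian_quotient_of_finiteDimensional (k : Type) [Field k] {A : Type} [Ring A]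
    [Algebra k A] {X : Type} [AddCommGroup X] [Module k X] [Module A X] [IsScalarTower k A X]
    (V : Submodule A X) (hV : FiniteDimensional k (X ⧸ V.restrictScalars k)) :
    IsArtinian A (X ⧸ V) := by
  have : FiniteDimensional k (X ⧸ V) :=
    Module.Finite.equiv (Submodule.Quotient.restrictScalarsEquiv k V)
  exact isArtinian_of_tower k inferInstance

lemma IsPseudocompactMod.isLinearlyCompact {k : Type} [Field k] {A : Type} [Ring A]
    [Algebra k A] [TopologicalSpace A] {X : Type} [AddCommGroup X] [Module k X] [Module A X]
    [IsScalarTower k A X] [TopologicalSpace X] (hX : IsPseudocompactMod k A X) :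
    IsLinearlyCompact A X := by
  have := hX.addGroup
  refine ⟨hX.t2, hX.addGroup, ?_, ?_⟩
  · intro s hs
    obtain ⟨V, ⟨hV, hfd⟩, hVs⟩ := hX.basis.mem_iff.1 hs
    exact ⟨V, hV, isArtinian_quotient_of_finiteDimensional k V hfd, hVs⟩
  intro ι _ hdir W hWc hWmono x hx
  rcases isEmpty_or_nonempty ι with hι | ⟨⟨i₀⟩⟩
  · exact ⟨0, fun i => hι.elim i⟩
  have hfilter : IsCosetFilter A
      {C : Set X | IsClosedCoset A C ∧ ∃ i, {y | y - x i ∈ W i} ⊆ C} := by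
    refine ⟨fun C hC => hC.1, ?_, ?_, ⟨⟨0, ⊤, isClosed_univ, by simp⟩, i₀, Set.subset_univ _⟩⟩
    · rintro C ⟨-, i, hi⟩
      exact ⟨x i, hi (by simp)⟩
    · rintro C ⟨hC, i, hi⟩ C' ⟨hC', j, hj⟩
      obtain ⟨l, hli, hlj⟩ := hdir i j
      have hsub : ∀ m, l ≤ m → {y | y - x l ∈ W l} ⊆ {y | y - x m ∈ W m} := by
        intro m hlm y hy
        simpa using (W m).add_mem (hWmono hlm hy) (hx l m hlm)
      have hsub' : {y | y - x l ∈ W l} ⊆ C ∩ C' :=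
        Set.subset_inter ((hsub i hli).trans hi) ((hsub j hlj).trans hj)
      exact ⟨hC.inter hC' ⟨x l, hsub' (by simp)⟩, l, hsub'⟩
  obtain ⟨𝓜, hsub, hmax⟩ := hfilter.exists_maximal
  have hex : ∀ V : {V : Submodule A X // IsOpen (V : Set X) ∧
      FiniteDimensional k (X ⧸ V.restrictScalars k)}, ∃ z, {y | y - z ∈ V.1} ∈ 𝓜 := by
    rintro ⟨V, hV, hfd⟩
    have := isArtinian_quotient_of_finiteDimensional k V hfd
    exact IsCosetFilter.exists_coset_mem hmax V hV
  choose z hz using hex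
  obtain ⟨t, ht⟩ := hX.complete (fun V => Submodule.Quotient.mk (z V)) (by
    intro V V' hle
    have hle' : V.1 ≤ V'.1.comap LinearMap.id := hle
    rw [mapQ', dif_pos hle', Submodule.mapQ_apply, LinearMap.id_apply, Submodule.Quotient.eq]
    obtain ⟨w, hw, hw'⟩ := hmax.prop.nonempty _ (hmax.prop.inter _ (hz V) _ (hz V'))
    simpa using V'.1.sub_mem hw' (hle hw))
  refine ⟨t, fun i => ?_⟩
  have hi : {y | y - x i ∈ W i} ∈ 𝓜 :=
    hsub ⟨⟨x i, W i, hWc i, rfl⟩, i, subset_rfl⟩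
  have hclosed : IsClosed {y | y - x i ∈ W i} :=
    (hWc i).preimage (continuous_id.sub continuous_const)
  by_contra hnot
  have hnhd : {v | t - v ∈ {y | y - x i ∈ W i}ᶜ} ∈ nhds (0 : X) := by
    refine (hclosed.isOpen_compl.preimage (continuous_const.sub continuous_id)).mem_nhds ?_
    simpa using hnot
  obtain ⟨V, hV, hVs⟩ := hX.basis.mem_iff.1 hnhd
  obtain ⟨w, hw, hw'⟩ := hmax.prop.nonempty _ (hmax.prop.inter _ hi _ (hz ⟨V, hV⟩))
  have htz : z ⟨V, hV⟩ - t ∈ V := (Submodule.Quotient.eq V).1 (ht ⟨V, hV⟩)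
  have htw : t - w ∈ V := by
    have := V.neg_mem (V.add_mem hw' htz)
    simpa using this
  have := hVs htw
  simp only [Set.mem_ofPred_eq, Set.mem_compl_iff, sub_sub_cancel] at this
  exact this hw

variable {A : Type} [Ring A] {X : Type} [AddCommGroup X] [Module A X] [TopologicalSpace X]

lemma IsLinearlyCompact.mem_of_forall_open (hX : IsLinearlyCompact A X) {K : Set X}
    (hK : IsClosed K) {x : X} (h : ∀ V : Submodule A X, IsOpen (V : Set X) →
      IsArtinian A (X ⧸ V) → ∃ y ∈ K, x - y ∈ V) : x ∈ K := by
  have := hX.addGroup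
  by_contra hnot
  obtain ⟨V, hV, hart, hVs⟩ := hX.basis {v | x - v ∈ Kᶜ} <| by
    refine (hK.isOpen_compl.preimage (continuous_const.sub continuous_id)).mem_nhds ?_
    simpa using hnot
  obtain ⟨y, hy, hxy⟩ := h V hV hart
  have := hVs hxy
  simp only [Set.mem_ofPred_eq, sub_sub_cancel] at this
  exact this hy

omit [TopologicalSpace X] in
lemma injective_mapQ_comap {Y : Type} [AddCommGroup Y] [Module A Y]
    (f : X →ₗ[A] Y) (V : Submodule A Y) :
    Function.Injective (Submodule.mapQ (V.comap f) V f le_rfl) := by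
  rw [← LinearMap.ker_eq_bot, Submodule.mapQ, Submodule.ker_liftQ_eq_bot]
  rw [LinearMap.ker_comp, Submodule.ker_mkQ]

omit [TopologicalSpace X] in
lemma isArtinian_quotient_comap {Y : Type} [AddCommGroup Y] [Module A Y]
    (f : X →ₗ[A] Y) (V : Submodule A Y) [IsArtinian A (Y ⧸ V)] :
    IsArtinian A (X ⧸ V.comap f) :=
  isArtinian_of_injective _ (injective_mapQ_comap f V)

omit [TopologicalSpace X] in
lemma isArtinian_quotient_map {Y : Type} [AddCommGroup Y] [Module A Y]
    (f : X →ₗ[A] Y) (hf : Function.Surjective f) (V : Submodule A X) [IsArtinian A (X ⧸ V)] :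
    IsArtinian A (Y ⧸ V.map f) :=
  isArtinian_of_surjective (X ⧸ V) (Submodule.mapQ V (V.map f) f (Submodule.le_comap_map f V)) <| by
    rw [← LinearMap.range_eq_top, Submodule.range_mapQ]
    simp [LinearMap.range_eq_top.2 hf]

lemma IsLinearlyCompact.quotient (hX : IsLinearlyCompact A X) {K : Submodule A X}
    (hK : IsClosed (K : Set X)) : IsLinearlyCompact A (X ⧸ K) := by
  have := hX.addGroup
  have := hX.t2
  refine ⟨inferInstance, inferInstance, ?_, ?_⟩
  · intro s hs
    obtain ⟨V, hV, hart, hVs⟩ := hX.basis (K.mkQ ⁻¹' s)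
      (K.continuous_mkQ.continuousAt.preimage_mem_nhds (by simpa using hs))
    refine ⟨V.map K.mkQ, ?_, isArtinian_quotient_map K.mkQ K.mkQ_surjective V, ?_⟩
    · simpa using K.isOpenMap_mkQ _ hV
    · rintro _ ⟨v, hv, rfl⟩
      exact hVs hv
  · intro ι _ hdir W hWc hWmono x hx
    obtain ⟨y, hy⟩ := hX.exists_mem_cosets ι hdir (fun i => (W i).comap K.mkQ)
      (fun i => (hWc i).preimage K.continuous_mkQ)
      (fun i j hij => Submodule.comap_mono (hWmono hij))
      (fun i => Function.surjInv K.mkQ_surjective (x i))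
      (fun i j hij => by
        simpa [-Submodule.mkQ_apply, Function.surjInv_eq K.mkQ_surjective] using hx i j hij)
    refine ⟨K.mkQ y, fun i => ?_⟩
    simpa [-Submodule.mkQ_apply, Function.surjInv_eq K.mkQ_surjective] using hy i

lemma IsLinearlyCompact.submodule (hX : IsLinearlyCompact A X) {S : Submodule A X}
    (hS : IsClosed (S : Set X)) : IsLinearlyCompact A S := by
  have := hX.addGroup
  have := hX.t2
  refine ⟨inferInstance, inferInstanceAs (IsTopologicalAddGroup S.toAddSubgroup), ?_, ?_⟩
  · intro s hs
    obtain ⟨u, hu, hus⟩ := mem_nhds_subtype _ _ _ |>.1 hs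
    obtain ⟨V, hV, hart, hVs⟩ := hX.basis u hu
    exact ⟨V.comap S.subtype, hV.preimage continuous_subtype_val,
      isArtinian_quotient_comap _ _, fun v hv => hus (hVs hv)⟩
  · intro ι _ hdir W hWc hWmono x hx
    rcases isEmpty_or_nonempty ι with hι | ⟨⟨i₀⟩⟩
    · exact ⟨0, fun i => hι.elim i⟩
    obtain ⟨y, hy⟩ := hX.exists_mem_cosets ι hdir (fun i => (W i).map S.subtype)
      (fun i => hS.isClosedMap_subtype_val _ (hWc i))
      (fun i j hij => Submodule.map_mono (hWmono hij)) (fun i => x i)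
      (fun i j hij => ⟨x i - x j, hx i j hij, rfl⟩)
    have hyS : y ∈ S := by
      obtain ⟨w, -, hw⟩ := hy i₀
      have := S.add_mem w.2 (x i₀).2
      rwa [show (w : X) = y - x i₀ from hw, sub_add_cancel] at this
    refine ⟨⟨y, hyS⟩, fun i => ?_⟩
    obtain ⟨w, hw, hw'⟩ := hy i
    have : w = ⟨y, hyS⟩ - x i := Subtype.ext hw'
    exact this ▸ hw

/-- A filtered intersection of closed submodules is eventually attained modulo an open
submodule with artinian quotient. -/
lemma IsLinearlyCompact.exists_le_sup_iInf (hX : IsLinearlyCompact A X) {ι : Type} [Preorder ι]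
    [Nonempty ι] (hdir : ∀ i j : ι, ∃ l, l ≤ i ∧ l ≤ j) (T : ι → Submodule A X)
    (hT : ∀ i, IsClosed (T i : Set X)) (hmono : Monotone T) (V : Submodule A X)
    (hV : IsOpen (V : Set X)) [IsArtinian A (X ⧸ V)] : ∃ i, T i ≤ V ⊔ ⨅ j, T j := by
  have := hX.addGroup
  obtain ⟨_, ⟨i, rfl⟩, hmin⟩ := IsArtinian.set_has_minimal
    (Set.range fun i => (T i).map V.mkQ) (Set.range_nonempty _)
  have hle : ∀ j, T i ≤ V ⊔ T j := by
    intro j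
    obtain ⟨l, hli, hlj⟩ := hdir i j
    have heq : (T l).map V.mkQ = (T i).map V.mkQ :=
      eq_of_le_of_not_lt (Submodule.map_mono (hmono hli)) (hmin _ ⟨l, rfl⟩)
    calc T i ≤ ((T i).map V.mkQ).comap V.mkQ := Submodule.le_comap_map _ _
      _ = V ⊔ T l := by rw [← heq, Submodule.comap_map_mkQ]
      _ ≤ V ⊔ T j := sup_le_sup_left (hmono hlj) V
  refine ⟨i, fun t ht => ?_⟩
  have hex : ∀ j, ∃ y ∈ T j, t - y ∈ V := by
    intro j
    obtain ⟨v, hv, y, hy, hvy⟩ := Submodule.mem_sup.1 (hle j ht)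
    exact ⟨y, hy, by simpa [← hvy] using hv⟩
  choose x hxT hxV using hex
  obtain ⟨y, hy⟩ := hX.exists_mem_cosets ι hdir (fun j => V ⊓ T j)
    (fun j => (isClosed_of_isOpen_submodule hV).inter (hT j))
    (fun j j' h => inf_le_inf_left V (hmono h)) x
    (fun j j' h => ⟨by simpa using V.sub_mem (hxV j') (hxV j),
      (T j').sub_mem (hmono h (hxT j)) (hxT j')⟩)
  refine Submodule.mem_sup.2 ⟨t - y, ?_, y, ?_, by abel⟩
  · have := V.sub_mem (hxV i) (hy i).1
    simpa using this
  · exact (Submodule.mem_iInf _).2 fun j => by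
      simpa using (T j).add_mem (hy j).2 (hxT j)

/-- A linearly compact module all of whose discrete artinian quotients are semisimple is
topologically semisimple. -/
lemma IsLinearlyCompact.isSemisimpleTop (hX : IsLinearlyCompact A X)
    (hss : ∀ V : Submodule A X, IsOpen (V : Set X) → IsArtinian A (X ⧸ V) →
      IsSemisimpleModule A (X ⧸ V)) : IsSemisimpleTop A X := by
  have := hX.addGroup
  have := hX.t2
  intro U hU
  obtain ⟨C, -, hC⟩ := zorn_le_nonempty₀ (α := (Submodule A X)ᵒᵈ)
    {C | IsClosed ((OrderDual.ofDual C : Submodule A X) : Set X) ∧ OrderDual.ofDual C ⊔ U = ⊤}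
    (by
      intro c hc hchain _ _
      let E : c → Submodule A X := fun C => OrderDual.ofDual C.1
      let _ : Preorder c := Preorder.lift E
      refine ⟨OrderDual.toDual (⨅ C, E C), ⟨?_, ?_⟩, fun C hC => iInf_le E ⟨C, hC⟩⟩
      · simp only [OrderDual.ofDual_toDual, Submodule.coe_iInf]
        exact isClosed_iInter fun C => (hc C.2).1
      · rw [OrderDual.ofDual_toDual, eq_top_iff]
        intro s _
        have hex : ∀ C, ∃ y ∈ E C, s - y ∈ U := by
          intro C
          obtain ⟨y, hy, u, hu, hyu⟩ := Submodule.mem_sup.1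
            (show s ∈ E C ⊔ U from (hc C.2).2 ▸ Submodule.mem_top)
          exact ⟨y, hy, by simpa [← hyu] using hu⟩
        choose x hxE hxU using hex
        rcases isEmpty_or_nonempty c with hemp | ⟨⟨C₀⟩⟩
        · simp [iInf_of_empty]
        obtain ⟨y, hy⟩ := hX.exists_mem_cosets c
          (fun C C' => (hchain.total C.2 C'.2).elim
            (fun h => ⟨C', h, le_refl (E C')⟩) (fun h => ⟨C, le_refl (E C), h⟩))
          (fun C => U ⊓ E C) (fun C => hU.inter (hc C.2).1)
          (fun C C' h => inf_le_inf_left U h) x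
          (fun C C' h => ⟨by simpa using U.sub_mem (hxU C') (hxU C),
            (E C').sub_mem (h (hxE C)) (hxE C')⟩)
        refine Submodule.mem_sup.2 ⟨y, ?_, s - y, ?_, by abel⟩
        · exact (Submodule.mem_iInf _).2 fun C => by
            simpa using (E C).add_mem (hy C).2 (hxE C)
        · simpa using U.sub_mem (hxU C₀) (hy C₀).1)
    (OrderDual.toDual ⊤) ⟨isClosed_univ, by simp⟩
  change Submodule A X at C
  have hCc : IsClosed (C : Set X) := hC.prop.1
  have hCU : C ⊔ U = ⊤ := hC.prop.2
  have hCmin : ∀ C' : Submodule A X, IsClosed (C' : Set X) → C' ⊔ U = ⊤ → C' ≤ C → C ≤ C' :=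
    fun C' h₁ h₂ h₃ => hC.le_of_ge (y := OrderDual.toDual C') ⟨h₁, h₂⟩ h₃
  refine ⟨C, hCc, ?_, codisjoint_iff.2 (by rw [sup_comm, hCU])⟩
  rw [disjoint_iff, eq_bot_iff]
  intro x hx
  refine hX.mem_of_forall_open (K := ((⊥ : Submodule A X) : Set X)) (by simp) fun V hV hart => ?_
  refine ⟨0, by simp, ?_⟩
  rw [sub_zero]
  have := hss V hV hart
  obtain ⟨Q, hQ⟩ := exists_isCompl ((U ⊓ C).map V.mkQ)
  let C' : Submodule A X := C ⊓ Q.comap V.mkQ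
  have hVQ : V ≤ Q.comap V.mkQ := by
    intro v hv
    simp [(Submodule.Quotient.mk_eq_zero V).2 hv]
  have hC'c : IsClosed (C' : Set X) :=
    hCc.inter (isClosed_of_isOpen_submodule (isOpen_submodule_of_le hVQ hV))
  have hC'U : C' ⊔ U = ⊤ := by
    rw [eq_top_iff, ← hCU]
    refine sup_le (fun c hc => ?_) le_sup_right
    have hcQ : V.mkQ c ∈ (U ⊓ C).map V.mkQ ⊔ Q := hQ.sup_eq_top ▸ Submodule.mem_top
    obtain ⟨_, ⟨u, hu, rfl⟩, q, hq, huq⟩ := Submodule.mem_sup.1 hcQ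
    refine Submodule.mem_sup.2 ⟨c - u, ⟨C.sub_mem hc hu.2, ?_⟩, u, hu.1, by abel⟩
    change V.mkQ (c - u) ∈ Q
    rw [map_sub, ← huq]
    simpa using hq
  have hxC' : x ∈ C' := hCmin C' hC'c hC'U inf_le_left hx.2
  have : V.mkQ x ∈ (U ⊓ C).map V.mkQ ⊓ Q := ⟨⟨x, hx, rfl⟩, hxC'.2⟩
  rw [hQ.inf_eq_bot, Submodule.mem_bot, Submodule.mkQ_apply, Submodule.Quotient.mk_eq_zero] at this
  exact this

lemma IsSemisimpleTop.isSemisimpleModule_quotient [IsTopologicalAddGroup X]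
    (hX : IsSemisimpleTop A X) {V : Submodule A X} (hV : IsOpen (V : Set X)) :
    IsSemisimpleModule A (X ⧸ V) := by
  rw [isSemisimpleModule_iff]
  refine ⟨fun Q => ?_⟩
  have hVQ : V ≤ Q.comap V.mkQ := by
    intro v hv
    simp [(Submodule.Quotient.mk_eq_zero V).2 hv]
  obtain ⟨C, -, hC⟩ := hX (Q.comap V.mkQ)
    (isClosed_of_isOpen_submodule (isOpen_submodule_of_le hVQ hV))
  refine ⟨C.map V.mkQ, ?_, ?_⟩
  · rw [disjoint_iff, eq_bot_iff]
    rintro _ ⟨hq, c, hc, rfl⟩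
    have : c ∈ Q.comap V.mkQ ⊓ C := ⟨hq, hc⟩
    rw [hC.inf_eq_bot, Submodule.mem_bot] at this
    simp [this]
  · rw [codisjoint_iff, ← Submodule.map_comap_eq_of_surjective V.mkQ_surjective Q,
      ← Submodule.map_sup, hC.sup_eq_top, Submodule.map_top, Submodule.range_mkQ]

variable (A X) in
omit [TopologicalSpace X] in
/-- The sum of all semisimple submodules of an abstract module. -/
def algSocle : Submodule A X := sSup {m | IsSemisimpleModule A m}

omit [TopologicalSpace X] in
instance : IsSemisimpleModule A (algSocle A X) := by
  rw [algSocle, sSup_eq_iSup]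
  exact isSemisimpleModule_biSup_of_isSemisimpleModule_submodule fun _ hm => hm

omit [TopologicalSpace X] in
lemma range_le_algSocle {Y : Type} [AddCommGroup Y] [Module A Y] [IsSemisimpleModule A Y]
    (f : Y →ₗ[A] X) : LinearMap.range f ≤ algSocle A X :=
  le_sSup (IsSemisimpleModule.range f)

omit [TopologicalSpace X] in
lemma map_mem_algSocle {Y : Type} [AddCommGroup Y] [Module A Y] (f : X →ₗ[A] Y) {x : X}
    (hx : x ∈ algSocle A X) : f x ∈ algSocle A Y :=
  range_le_algSocle (f ∘ₗ (algSocle A X).subtype) ⟨⟨x, hx⟩, rfl⟩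

variable (A X) in
/-- The elements whose image in every discrete artinian quotient lies in the socle. -/
def openSocle : Submodule A X :=
  ⨅ (V : Submodule A X) (_ : IsOpen (V : Set X) ∧ IsArtinian A (X ⧸ V)),
    (algSocle A (X ⧸ V)).comap V.mkQ

lemma mem_openSocle {x : X} : x ∈ openSocle A X ↔ ∀ V : Submodule A X, IsOpen (V : Set X) →
    IsArtinian A (X ⧸ V) → V.mkQ x ∈ algSocle A (X ⧸ V) := by
  simp [openSocle, Submodule.mem_iInf]

lemma map_mem_openSocle {Y : Type} [AddCommGroup Y] [Module A Y] [TopologicalSpace Y]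
    (f : X →ₗ[A] Y) (hf : Continuous f) {x : X} (hx : x ∈ openSocle A X) :
    f x ∈ openSocle A Y :=
  mem_openSocle.2 fun V hV _ =>
    map_mem_algSocle (Submodule.mapQ (V.comap f) V f le_rfl)
      (mem_openSocle.1 hx (V.comap f) (hV.preimage hf) (isArtinian_quotient_comap f V))

lemma isClosed_openSocle [IsTopologicalAddGroup X] : IsClosed (openSocle A X : Set X) := by
  simp only [openSocle, Submodule.coe_iInf]
  refine isClosed_iInter fun V => isClosed_iInter fun hV => isClosed_of_isOpen_submodule ?_
  refine isOpen_submodule_of_le (fun v hv => ?_) hV.1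
  simp [(Submodule.Quotient.mk_eq_zero V).2 hv]

lemma IsLinearlyCompact.socle_eq_openSocle (hX : IsLinearlyCompact A X) :
    socle A X = openSocle A X := by
  have := hX.addGroup
  apply le_antisymm
  · refine sSup_le fun W ⟨_, hW⟩ x hx => mem_openSocle.2 fun V hV _ => ?_
    have : IsTopologicalAddGroup W := inferInstanceAs (IsTopologicalAddGroup W.toAddSubgroup)
    have := hW.isSemisimpleModule_quotient (V := V.comap W.subtype)
      (hV.preimage continuous_subtype_val)
    exact range_le_algSocle (Submodule.mapQ (V.comap W.subtype) V W.subtype le_rfl)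
      ⟨Submodule.Quotient.mk ⟨x, hx⟩, rfl⟩
  · refine le_sSup ⟨isClosed_openSocle, ?_⟩
    refine (hX.submodule isClosed_openSocle).isSemisimpleTop fun V hV _ => ?_
    obtain ⟨u, hu, hus⟩ := (mem_nhds_subtype _ _ _).1 (hV.mem_nhds V.zero_mem)
    obtain ⟨V', hV', hart, hVs⟩ := hX.basis u hu
    let f := Submodule.mapQ (V'.comap (openSocle A X).subtype) V' (openSocle A X).subtype le_rfl
    have hf : Function.Injective f := injective_mapQ_comap _ _
    have hmem : ∀ z, f z ∈ algSocle A (X ⧸ V') := by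
      intro z
      obtain ⟨s, rfl⟩ := Submodule.Quotient.mk_surjective _ z
      exact mem_openSocle.1 s.2 V' hV' hart
    have := IsSemisimpleModule.of_injective (f.codRestrict _ hmem)
      (fun a b hab => hf (congrArg Subtype.val hab))
    exact IsSemisimpleModule.of_surjective
      (Submodule.factor (fun v hv => hus (hVs hv) : V'.comap (openSocle A X).subtype ≤ V))
      (Submodule.factor_surjective _)

lemma map_mem_radical {Y : Type} [AddCommGroup Y] [Module A Y] [TopologicalSpace Y]
    (f : X →ₗ[A] Y) (hf : Continuous f) (hsurj : Function.Surjective f) {x : X}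
    (hx : x ∈ radical A X) : f x ∈ radical A Y := by
  refine (Submodule.mem_sInf).2 fun W ⟨hW, hWo⟩ => ?_
  exact (Submodule.mem_sInf).1 hx (W.comap f)
    ⟨(Submodule.isCoatom_comap_iff hsurj).2 hW, hWo.preimage hf⟩

lemma isClosed_radical [IsTopologicalAddGroup X] : IsClosed (radical A X : Set X) := by
  rw [radical, Submodule.coe_sInf]
  exact isClosed_biInter fun W hW => isClosed_of_isOpen_submodule hW.2

lemma isOpen_map_mkQ [IsTopologicalAddGroup X] (K : Submodule A X) {V : Submodule A X}
    (hV : IsOpen (V : Set X)) : IsOpen (V.map K.mkQ : Set (X ⧸ K)) :=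
  K.isOpenMap_mkQ _ hV

lemma mem_radical_of_forall_mkQ [IsTopologicalAddGroup X] {ι : Type} {K : ι → Submodule A X}
    (hK : ∀ V : Submodule A X, IsOpen (V : Set X) → ∃ i, K i ≤ V) {x : X}
    (hx : ∀ i, (K i).mkQ x ∈ radical A (X ⧸ K i)) : x ∈ radical A X := by
  refine (Submodule.mem_sInf).2 fun W ⟨hW, hWo⟩ => ?_
  obtain ⟨i, hi⟩ := hK W hWo
  have heq : (W.map (K i).mkQ).comap (K i).mkQ = W := by
    rw [Submodule.comap_map_mkQ, sup_eq_right.2 hi]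
  have := (Submodule.mem_sInf).1 (hx i) (W.map (K i).mkQ)
    ⟨(Submodule.isCoatom_comap_iff (K i).mkQ_surjective).1 (heq.symm ▸ hW), isOpen_map_mkQ _ hWo⟩
  rwa [← heq]

lemma mem_openSocle_of_forall_mkQ [IsTopologicalAddGroup X] {ι : Type} {K : ι → Submodule A X}
    (hK : ∀ V : Submodule A X, IsOpen (V : Set X) → ∃ i, K i ≤ V) {x : X}
    (hx : ∀ i, (K i).mkQ x ∈ openSocle A (X ⧸ K i)) : x ∈ openSocle A X := by
  refine mem_openSocle.2 fun V hV _ => ?_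
  obtain ⟨i, hi⟩ := hK V hV
  have hmap := mem_openSocle.1 (hx i) (V.map (K i).mkQ) (isOpen_map_mkQ _ hV)
    (isArtinian_quotient_map _ (K i).mkQ_surjective V)
  have hle : V.map (K i).mkQ ≤ LinearMap.ker (Submodule.factor hi) := by
    rintro _ ⟨v, hv, rfl⟩
    simpa using hv
  exact map_mem_algSocle (Submodule.liftQ _ (Submodule.factor hi) hle) hmap

omit [TopologicalSpace X] in
lemma subQuotMap_mk {Y : Type} [AddCommGroup Y] [Module A Y] {W W' : Submodule A X}
    {V V' : Submodule A Y} {f : X →ₗ[A] Y} (h : ∀ x ∈ W, f x ∈ V) (h' : ∀ x ∈ W', f x ∈ V')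
    (x : X) (hx : x ∈ W) :
    subQuotMap W W' V V' f (Submodule.Quotient.mk ⟨x, hx⟩) =
      Submodule.Quotient.mk ⟨f x, h x hx⟩ := by
  have hr : restrict' W V f = f.restrict h := dif_pos h
  have hle : W'.comap W.subtype ≤ (V'.comap V.subtype).comap (restrict' W V f) := by
    intro w hw
    rw [hr]
    exact h' _ hw
  rw [subQuotMap, mapQ', dif_pos hle, Submodule.mapQ_apply, hr]
  rfl

/-- A module mapping onto the compatible families of an inverse system, in such a way that its
topology is generated by the components modulo the kernel, has the inverse limit as quotient. -/
lemma nonempty_quotient_equiv_compatLim [IsTopologicalAddGroup X] (N : Submodule A X)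
    {ι : Type} [Preorder ι] {T : ι → Type} [∀ i, AddCommGroup (T i)] [∀ i, Module A (T i)]
    [∀ i, TopologicalSpace (T i)] [∀ i, IsTopologicalAddGroup (T i)]
    {t : ∀ i j, i ≤ j → (T i →ₗ[A] T j)} (g : ∀ i, X →ₗ[A] T i)
    (hcont : ∀ i, Continuous (g i)) (hcompat : ∀ i j h x, t i j h (g i x) = g j x)
    (hker : ∀ x, x ∈ N ↔ ∀ i, g i x = 0)
    (hsurj : ∀ f : ∀ i, T i, (∀ i j h, t i j h (f i) = f j) → ∃ x, ∀ i, g i x = f i)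
    (hopen : ∀ s ∈ nhds (0 : X), ∃ i, ∃ O ∈ nhds (0 : T i), ∀ x, g i x ∈ O →
      ∃ x' ∈ s, x - x' ∈ N) :
    Nonempty ((X ⧸ N) ≃L[A] compatLim T t) := by
  let Φ : X →ₗ[A] compatLim T t :=
    (LinearMap.pi g).codRestrict _ fun x i j h => hcompat i j h x
  have hΦcont : Continuous Φ := (continuous_pi hcont).subtype_mk _
  have hΦsurj : Function.Surjective Φ := by
    rintro ⟨f, hf⟩
    obtain ⟨x, hx⟩ := hsurj f hf
    exact ⟨x, Subtype.ext (funext hx)⟩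
  have hΦker : N = LinearMap.ker Φ := by
    ext x
    rw [hker, LinearMap.mem_ker]
    exact ⟨fun h => Subtype.ext (funext h), fun h i => congrFun (congrArg Subtype.val h) i⟩
  let E : (X ⧸ N) ≃ₗ[A] compatLim T t :=
    (Submodule.quotEquivOfEq _ _ hΦker).trans (Φ.quotKerEquivOfSurjective hΦsurj)
  have hE : ∀ x, E (N.mkQ x) = Φ x := fun x => rfl
  have : IsTopologicalAddGroup (compatLim T t) :=
    inferInstanceAs (IsTopologicalAddGroup (compatLim T t).toAddSubgroup)
  refine ⟨{ E with continuous_toFun := ?_, continuous_invFun := ?_ }⟩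
  · exact N.isQuotientMap_mkQ.continuous_iff.2 hΦcont
  change Continuous E.symm.toAddMonoidHom
  refine continuous_of_continuousAt_zero _ fun s hs => ?_
  rw [map_zero] at hs
  obtain ⟨i, O, hO, hOs⟩ := hopen (N.mkQ ⁻¹' s)
    (N.continuous_mkQ.continuousAt.preimage_mem_nhds (by simpa using hs))
  have hOlim : (fun y : compatLim T t => (y : ∀ i, T i) i) ⁻¹' O ∈ nhds 0 :=
    ((continuous_apply i).comp continuous_subtype_val).continuousAt.preimage_mem_nhds hO
  refine Filter.mem_map.2 (Filter.mem_of_superset hOlim fun y hy => ?_)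
  obtain ⟨x, rfl⟩ := hΦsurj y
  obtain ⟨x', hx', hxx'⟩ := hOs x hy
  change E.symm (Φ x) ∈ s
  rw [← hE, LinearEquiv.symm_apply_apply]
  have : N.mkQ x = N.mkQ x' := (Submodule.Quotient.eq N).2 hxx'
  rwa [this]

/-- For a linearly compact module, `Rad(X)/Soc(X)` is the inverse limit of the modules
`Rad(X/K)/Soc(X/K)` along any filtered system of closed submodules `K` converging to zero. -/
theorem IsLinearlyCompact.nonempty_rad_mod_soc_equiv_limit (hX : IsLinearlyCompact A X)
    {ι : Type} [Preorder ι] [Nonempty ι] (hdir : ∀ i j : ι, ∃ l, l ≤ i ∧ l ≤ j)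
    (K : ι → Submodule A X) (hKc : ∀ i, IsClosed (K i : Set X)) (hmono : Monotone K)
    (hK : ∀ V : Submodule A X, IsOpen (V : Set X) → ∃ i, K i ≤ V) :
    Nonempty ((subQuot (radical A X) (socle A X)) ≃L[A]
      compatLim (fun i => subQuot (radical A (X ⧸ K i)) (socle A (X ⧸ K i)))
        (fun i j h => subQuotMap _ _ _ _
          (Submodule.mapQ (K i) (K j) LinearMap.id (fun _ hx => hmono h hx)))) := by
  have := hX.addGroup
  have hsoc : ∀ i, socle A (X ⧸ K i) = openSocle A (X ⧸ K i) := fun i =>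
    (hX.quotient (hKc i)).socle_eq_openSocle
  have hcont : ∀ i j (h : i ≤ j), Continuous
      (Submodule.mapQ (K i) (K j) LinearMap.id (fun _ hx => hmono h hx)) := fun i j h =>
    (K i).isQuotientMap_mkQ.continuous_iff.2 (K j).continuous_mkQ
  have hrad : ∀ i, ∀ x ∈ radical A X, (K i).mkQ x ∈ radical A (X ⧸ K i) := fun i x hx =>
    map_mem_radical _ (K i).continuous_mkQ (K i).mkQ_surjective hx
  have htrad : ∀ i j (h : i ≤ j), ∀ x ∈ radical A (X ⧸ K i),
      Submodule.mapQ (K i) (K j) LinearMap.id (fun _ hx => hmono h hx) x ∈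
        radical A (X ⧸ K j) := fun i j h x hx => by
    refine map_mem_radical _ (hcont i j h) (fun z => ?_) hx
    obtain ⟨y, rfl⟩ := (K j).mkQ_surjective z
    exact ⟨(K i).mkQ y, rfl⟩
  have htsoc : ∀ i j (h : i ≤ j), ∀ x ∈ socle A (X ⧸ K i),
      Submodule.mapQ (K i) (K j) LinearMap.id (fun _ hx => hmono h hx) x ∈
        socle A (X ⧸ K j) := fun i j h x hx => by
    rw [hsoc] at hx ⊢
    exact map_mem_openSocle _ (hcont i j h) hx
  let g : ∀ i, radical A X →ₗ[A] subQuot (radical A (X ⧸ K i)) (socle A (X ⧸ K i)) := fun i =>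
    (Submodule.mkQ _) ∘ₗ (K i).mkQ.restrict (hrad i)
  have hg : ∀ i x, g i x = 0 ↔ (K i).mkQ (x : X) ∈ openSocle A (X ⧸ K i) := by
    intro i x
    rw [← hsoc]
    exact Submodule.Quotient.mk_eq_zero _
  have hTAG : IsTopologicalAddGroup (radical A X) :=
    inferInstanceAs (IsTopologicalAddGroup (radical A X).toAddSubgroup)
  have hTAG' : ∀ i, IsTopologicalAddGroup (radical A (X ⧸ K i)) := fun i =>
    inferInstanceAs (IsTopologicalAddGroup (radical A (X ⧸ K i)).toAddSubgroup)
  refine nonempty_quotient_equiv_compatLim ((socle A X).comap (radical A X).subtype) g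
    (fun i => ?_) (fun i j h x => ?_) (fun x => ?_) ?_ ?_
  · exact (Submodule.continuous_mkQ _).comp
      (((K i).continuous_mkQ.comp continuous_subtype_val).subtype_mk _)
  · exact subQuotMap_mk (htrad i j h) (htsoc i j h) _ (hrad i x x.2)
  · rw [hX.socle_eq_openSocle]
    exact ⟨fun hx i => (hg i x).2 (map_mem_openSocle _ (K i).continuous_mkQ hx),
      fun hx => mem_openSocle_of_forall_mkQ hK fun i => (hg i x).1 (hx i)⟩
  · intro f hf
    have hex : ∀ i, ∃ x : X, ∃ h : (K i).mkQ x ∈ radical A (X ⧸ K i),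
        f i = Submodule.Quotient.mk ⟨(K i).mkQ x, h⟩ := by
      intro i
      obtain ⟨⟨z, hz⟩, hzf⟩ := Submodule.Quotient.mk_surjective _ (f i)
      obtain ⟨x, rfl⟩ := (K i).mkQ_surjective z
      exact ⟨x, hz, hzf.symm⟩
    choose x hxrad hxf using hex
    obtain ⟨y, hy⟩ := hX.exists_mem_cosets ι hdir
      (fun i => (radical A (X ⧸ K i) ⊓ openSocle A (X ⧸ K i)).comap (K i).mkQ)
      (fun i => (isClosed_radical.inter isClosed_openSocle).preimage (K i).continuous_mkQ)
      (fun i j h z hz => ⟨htrad i j h _ hz.1, by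
        have := htsoc i j h ((K i).mkQ z)
        rw [hsoc, hsoc] at this
        exact this hz.2⟩) x
      (fun i j h => by
        have h₁ := hf i j h
        rw [hxf i, hxf j, subQuotMap_mk (htrad i j h) (htsoc i j h), Submodule.Quotient.eq] at h₁
        refine ⟨(radical A (X ⧸ K j)).sub_mem (htrad i j h _ (hxrad i)) (hxrad j), ?_⟩
        rw [← hsoc]
        exact h₁)
    have hyrad : y ∈ radical A X := mem_radical_of_forall_mkQ hK fun i => by
      have := (radical A (X ⧸ K i)).add_mem (hy i).1 (hxrad i)
      rwa [← map_add, sub_add_cancel] at this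
    refine ⟨⟨y, hyrad⟩, fun i => ?_⟩
    refine Eq.trans ?_ (hxf i).symm
    refine (Submodule.Quotient.eq _).2 ?_
    have := (hy i).2
    rw [← hsoc] at this
    exact this
  intro s hs
  obtain ⟨u, hu, hus⟩ := (mem_nhds_subtype _ _ _).1 hs
  obtain ⟨V, hV, hart, hVu⟩ := hX.basis u hu
  let T : ι → Submodule A X := fun i =>
    (radical A (X ⧸ K i) ⊓ openSocle A (X ⧸ K i)).comap (K i).mkQ
  obtain ⟨i, hi⟩ := hX.exists_le_sup_iInf hdir T
    (fun i => (isClosed_radical.inter isClosed_openSocle).preimage (K i).continuous_mkQ)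
    (fun i j h z hz => ⟨htrad i j h _ hz.1, by
        have := htsoc i j h ((K i).mkQ z)
        rw [hsoc, hsoc] at this
        exact this hz.2⟩) V hV
  refine ⟨i, _, (isOpen_map_mkQ ((socle A (X ⧸ K i)).comap (radical A (X ⧸ K i)).subtype)
    (V := (V.map (K i).mkQ).comap (radical A (X ⧸ K i)).subtype)
    ((isOpen_map_mkQ (K i) hV).preimage continuous_subtype_val)).mem_nhds
      (Submodule.zero_mem _), fun x hy => ?_⟩
  obtain ⟨⟨_, hvrad⟩, ⟨v, hv, rfl⟩, hvx⟩ := hy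
  have hxv : (x : X) - v ∈ T i := by
    have h₁ := (Submodule.Quotient.eq _).1 hvx.symm
    refine ⟨(radical A (X ⧸ K i)).sub_mem (hrad i x x.2) hvrad, ?_⟩
    rw [← hsoc]
    exact h₁
  obtain ⟨w, hw, t, ht, hwt⟩ := Submodule.mem_sup.1 (hi hxv)
  have ht' := (Submodule.mem_iInf _).1 ht
  have htrad' : t ∈ radical A X := mem_radical_of_forall_mkQ hK fun j => (ht' j).1
  have htsoc' : t ∈ socle A X := by
    rw [hX.socle_eq_openSocle]
    exact mem_openSocle_of_forall_mkQ hK fun j => (ht' j).2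
  refine ⟨x - ⟨t, htrad'⟩, hus (hVu ?_), by simpa using htsoc'⟩
  change ((x - ⟨t, htrad'⟩ : radical A X) : X) ∈ V
  have : ((x - ⟨t, htrad'⟩ : radical A X) : X) = w + v := by
    rw [AddSubgroupClass.coe_sub, sub_eq_iff_eq_add]
    rw [eq_sub_iff_add_eq] at hwt
    rw [← hwt]
    abel
  rw [this]
  exact V.add_mem hw hv

end LinearlyCompact

section CompletedGroupAlgebra

variable {k : Type} [Field k] {G : Type} [Group G] [TopologicalSpace G]

lemma continuous_ofG [IsTopologicalGroup G] : Continuous (ofG k G) := by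
  refine Continuous.subtype_mk (continuous_pi fun N => ?_) _
  have : DiscreteTopology (G ⧸ N.toSubgroup) :=
    QuotientGroup.discreteTopology N.isOpen'
  exact (continuous_of_discreteTopology
    (f := fun q : G ⧸ N.toSubgroup => (MonoidAlgebra.single q 1 : MonoidAlgebra k _))).comp
      continuous_quotient_mk'

lemma isClosed_coinvKer (N : OpenNormalSubgroup G) (U : Type) [AddCommGroup U]
    [Module (CGA k G) U] [TopologicalSpace U] : IsClosed (coinvKer k G N U : Set U) := by
  rw [coinvKer, Submodule.coe_sInf]
  exact isClosed_biInter fun W hW => hW.1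

/-- Every open submodule of a pseudocompact module contains `I_N U` for some `N`. -/
lemma IsPseudocompactMod.exists_coinvKer_le [IsTopologicalGroup G] [CompactSpace G]
    [TotallyDisconnectedSpace G] {U : Type} [AddCommGroup U] [Module k U]
    [Module (CGA k G) U] [IsScalarTower k (CGA k G) U] [TopologicalSpace U]
    (hU : IsPseudocompactMod k (CGA k G) U) {V₀ : Submodule (CGA k G) U}
    (hV₀ : IsOpen (V₀ : Set U)) : ∃ N : OpenNormalSubgroup G, coinvKer k G N U ≤ V₀ := by
  have := hU.addGroup
  have := hU.contSMul
  obtain ⟨V, ⟨hV, hfd⟩, hVV₀⟩ := hU.basis.mem_iff.1 (hV₀.mem_nhds V₀.zero_mem)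
  obtain ⟨s, hs⟩ := hfd.fg_top
  let lift := Function.surjInv (V.restrictScalars k).mkQ_surjective
  have hlift : ∀ q, (V.restrictScalars k).mkQ (lift q) = q :=
    Function.surjInv_eq (V.restrictScalars k).mkQ_surjective
  obtain ⟨N, hN⟩ := ProfiniteGrp.exist_openNormalSubgroup_sub_open_nhds_of_one
    (G := G) (U := ⋂ q ∈ s, {g : G | ofG k G g • lift q - lift q ∈ V})
    (isOpen_biInter_finset fun q _ => hV.preimage
      ((continuous_ofG.smul continuous_const).sub continuous_const)) (by simp)
  refine ⟨N, le_trans (sInf_le ⟨isClosed_of_isOpen_submodule hV, fun n hn u => ?_⟩) hVV₀⟩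
  let W : Submodule k U :=
    { carrier := {u | ofG k G n • u - u ∈ V}
      add_mem' := fun {a b} ha hb => by
        have := V.add_mem ha hb
        rwa [sub_add_sub_comm, ← smul_add] at this
      zero_mem' := by simp
      smul_mem' := fun c u hu => by
        have := V.smul_of_tower_mem c hu
        rwa [smul_sub, smul_comm] at this }
  have hVW : V.restrictScalars k ≤ W := fun v hv => V.sub_mem (V.smul_mem _ hv) hv
  have htop : W.map (V.restrictScalars k).mkQ = ⊤ := by
    rw [eq_top_iff, ← hs, Submodule.span_le]
    intro q hq
    exact ⟨lift q, Set.mem_iInter₂.1 (hN hn) q hq, hlift q⟩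
  have hW : W = ⊤ := by
    have := congrArg (Submodule.comap (V.restrictScalars k).mkQ) htop
    rwa [Submodule.comap_map_mkQ, sup_eq_right.2 hVW, Submodule.comap_top] at this
  exact (hW ▸ Submodule.mem_top : u ∈ W)

end CompletedGroupAlgebra

/-- Lemma 3.6: for an indecomposable projective module `P` of a
block with non-trivial cyclic defect group, `Rad(P)/Soc(P)` is the inverse limit over
`N ∈ 𝒩` of `Rad(P_N)/Soc(P_N)`. -/
theorem rad_mod_soc_iso_limit
    (p : ℕ) [Fact p.Prime] (k : Type) [Field k] [CharP k p] [IsAlgClosed k]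
    (G : Type) [Group G] [TopologicalSpace G] [IsTopologicalGroup G]
    [CompactSpace G] [TotallyDisconnectedSpace G] [T2Space G]
    (e : CGA k G) (he : IsBlockIdem (CGA k G) e)
    (D : Subgroup G) (hD : IsDefectGroup k G e D)
    (hcyc : IsCyclicProP G p D) (hnt : D ≠ ⊥)
    (P : Type) [AddCommGroup P] [Module k P] [Module (CGA k G) P]
    [IsScalarTower k (CGA k G) P] [TopologicalSpace P]
    (hPpc : IsPseudocompactMod k (CGA k G) P) (hPproj : IsPCProjective k G P)
    (hPind : IsIndecTop (CGA k G) P) (hPe : InBlock (CGA k G) (X := P) e)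
    (𝒩 : Set (OpenNormalSubgroup G)) (hcof : IsCofinal 𝒩)
    (hgood : ∀ N ∈ 𝒩, GoodN k G e D N) :
    Nonempty ((subQuot (radical (CGA k G) P) (socle (CGA k G) P)) ≃L[CGA k G]
      compatLim (fun N : 𝒩 =>
          subQuot (radical (CGA k G) (coinv k G N.1 P))
            (socle (CGA k G) (coinv k G N.1 P)))
        (fun N M h => subQuotMap _ _ _ _ (phiT k G N.1 M.1 h P))) := by
  have hK : ∀ V : Submodule (CGA k G) P, IsOpen (V : Set P) →
      ∃ N : 𝒩, coinvKer k G N.1 P ≤ V := by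
    intro V hV
    obtain ⟨M, hM⟩ := hPpc.exists_coinvKer_le hV
    obtain ⟨N, hN, hNM⟩ := hcof M
    exact ⟨⟨N, hN⟩, (coinvKer_mono hNM P).trans hM⟩
  obtain ⟨N₀, -⟩ := hK ⊤ isOpen_univ
  have : Nonempty 𝒩 := ⟨N₀⟩
  refine hPpc.isLinearlyCompact.nonempty_rad_mod_soc_equiv_limit (fun N M => ?_)
    (fun N : 𝒩 => coinvKer k G N.1 P) (fun N => isClosed_coinvKer N.1 P)
    (fun N M h => coinvKer_mono h P) hK
  obtain ⟨L, hL, hLle⟩ := hcof (N.1 ⊓ M.1)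
  exact ⟨⟨L, hL⟩, hLle.trans inf_le_left, hLle.trans inf_le_right⟩

end ProfiniteBlocks
end
end
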